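/- arXiv:1507.03526 — 8 statements merged into one kernel-verified Lean document; each statement's English description precedes it below -/
import Mathlib

section
/- Let A : (0,∞) → M_d(ℝ) be a matrix-valued complete Bernstein function with representation A(x) = B + x·C + x·∫_{(0,∞)} (x+s)^{-1} N(ds), where N(ds) = M(s) μ(ds) is a positive-semidefinite-matrix-valued measure, and set A₀(z) := A(z) − B − z·C. Then for every 0 < a < b such that a and b are continuity points of the measure N, one has N((a,b]) = (1/π) · lim_{ε→0+} ∫_{(a,b]} Im[ A₀(−s + iε) / (s − iε) ] ds. -/
open MeasureTheory Complex Filter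
open scoped ComplexOrder Matrix

noncomputable section

/-- The "imaginary part" `(X - Xᴴ)/(2i)` of a complex square matrix. -/
def Matrix.imP {d : ℕ} (X : Matrix (Fin d) (Fin d) ℂ) : Matrix (Fin d) (Fin d) ℂ :=
  (2 * Complex.I)⁻¹ • (X - Xᴴ)

/-- `F` witnesses that `A : (0,∞) → M_d(ℝ)` is a matrix-valued complete Bernstein function:
`F` is an analytic continuation of `A` to the cut plane `ℂ ∖ (−∞,0]` satisfying
`(Im z)·Im F(z) ≥ 0` there, and `A` has a (real) limit at `0+`. -/
def IsMvCBFWith {d : ℕ} (A : ℝ → Matrix (Fin d) (Fin d) ℝ)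
    (F : ℂ → Matrix (Fin d) (Fin d) ℂ) : Prop :=
  (∀ i j, DifferentiableOn ℂ (fun z => F z i j) Complex.slitPlane) ∧
  (∀ x : ℝ, 0 < x → F (x : ℂ) = (A x).map (fun t => (t : ℂ))) ∧
  (∀ z ∈ Complex.slitPlane, (((z.im : ℂ)) • (F z).imP).PosSemidef) ∧
  (∃ L : Matrix (Fin d) (Fin d) ℝ, Tendsto A (nhdsWithin 0 (Set.Ioi 0)) (nhds L))

/-- `A : (0,∞) → M_d(ℝ)` is a matrix-valued complete Bernstein function. -/
def IsMvCBF {d : ℕ} (A : ℝ → Matrix (Fin d) (Fin d) ℝ) : Prop :=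
  ∃ F : ℂ → Matrix (Fin d) (Fin d) ℂ, IsMvCBFWith A F

/-- A measure for which some a.e. positive measurable function has finite integral is s-finite. -/
theorem sFinite_of_lintegral_ofReal_ne_top {α : Type*} [MeasurableSpace α] {ν : Measure α}
    {g : α → ℝ} (hg : Measurable g) (hpos : ∀ᵐ x ∂ν, 0 < g x)
    (hfin : (∫⁻ x, ENNReal.ofReal (g x) ∂ν) ≠ ⊤) : SFinite ν := by
  have hfin' : IsFiniteMeasure (ν.withDensity fun x => ENNReal.ofReal (g x)) :=
    isFiniteMeasure_withDensity hfin
  have h := withDensity_inv_same (μ := ν) (f := fun x => ENNReal.ofReal (g x)) hg.ennreal_ofReal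
    (by filter_upwards [hpos] with x hx using by simpa using hx)
    (by filter_upwards with x using ENNReal.ofReal_ne_top)
  rw [← h]
  infer_instance

theorem Complex.exists_nhds_norm_inv_add_ofReal_le {z₀ : ℂ} (hz₀ : z₀ ∈ slitPlane) :
    ∃ U ∈ nhds z₀, ∃ K : ℝ, ∀ z ∈ U, ∀ s : ℝ, 0 ≤ s →
      z + s ≠ 0 ∧ ‖(z + s)⁻¹‖ ≤ K * (1 + s)⁻¹ := by
  obtain ⟨δ, hδ, hball⟩ := Metric.isOpen_iff.1 isOpen_slitPlane z₀ hz₀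
  refine ⟨Metric.ball z₀ (δ / 2), Metric.ball_mem_nhds _ (by positivity),
    2 * (1 + (1 + ‖z₀‖) / δ), fun z hz s hs => ?_⟩
  have h1 : δ ≤ ‖z₀ + s‖ := by
    by_contra! hlt
    have hmem : (-(s : ℂ)) ∈ slitPlane := hball (by
      rw [Metric.mem_ball, dist_comm, dist_eq_norm, sub_neg_eq_add]; exact hlt)
    rw [mem_slitPlane_iff] at hmem
    simp at hmem
    linarith
  have h2 : s - ‖z₀‖ ≤ ‖z₀ + s‖ := by
    have := norm_sub_norm_le (s : ℂ) (-z₀)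
    rw [sub_neg_eq_add, norm_neg, norm_real, Real.norm_of_nonneg hs, add_comm] at this
    exact this
  have h3 : ‖z₀ + s‖ / 2 ≤ ‖z + s‖ := by
    have := norm_sub_norm_le (z₀ + s) (z + s)
    rw [add_sub_add_right_eq_sub] at this
    rw [Metric.mem_ball, dist_comm, dist_eq_norm] at hz
    linarith
  have h4 : 0 < ‖z + s‖ := by linarith
  refine ⟨norm_pos_iff.1 h4, ?_⟩
  rw [norm_inv, ← div_eq_mul_inv, inv_eq_one_div, div_le_div_iff₀ h4 (by positivity)]
  have h5 : 1 + ‖z₀‖ ≤ (1 + ‖z₀‖) / δ * ‖z₀ + s‖ := by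
    rw [div_mul_eq_mul_div, le_div_iff₀ hδ]
    gcongr
  have h6 : (2 * (1 + (1 + ‖z₀‖) / δ)) * (‖z₀ + s‖ / 2)
      ≤ (2 * (1 + (1 + ‖z₀‖) / δ)) * ‖z + s‖ := by gcongr
  linarith

section StieltjesTransform

variable {ν : Measure ℝ} {f : ℝ → ℝ}

theorem integrable_inv_add_mul (hν : ∀ᵐ s ∂ν, 0 < s) (hfm : Measurable f)
    (hf : Integrable (fun s => (1 + s)⁻¹ * f s) ν) {z : ℂ} (hz : z ∈ slitPlane) :
    Integrable (fun s : ℝ => (z + s)⁻¹ * (f s : ℂ)) ν := by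
  obtain ⟨U, hU, K, hK⟩ := exists_nhds_norm_inv_add_ofReal_le hz
  refine (hf.norm.const_mul K).mono' (by fun_prop) ?_
  filter_upwards [hν] with s hs
  rw [norm_mul, norm_mul, norm_real, ← mul_assoc,
    Real.norm_of_nonneg (r := (1 + s)⁻¹) (by positivity)]
  gcongr
  exact (hK z (mem_of_mem_nhds hU) s hs.le).2

theorem differentiableOn_integral_inv_add_mul (hν : ∀ᵐ s ∂ν, 0 < s) (hfm : Measurable f)
    (hf : Integrable (fun s => (1 + s)⁻¹ * f s) ν) :
    DifferentiableOn ℂ (fun z : ℂ => ∫ s, (z + s)⁻¹ * (f s : ℂ) ∂ν) slitPlane := by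
  intro z₀ hz₀
  obtain ⟨U, hU, K, hK⟩ := exists_nhds_norm_inv_add_ofReal_le hz₀
  refine (hasDerivAt_integral_of_dominated_loc_of_deriv_le
    (F' := fun z s => -1 / (z + s) ^ 2 * (f s : ℂ))
    (bound := fun s => K * (K * ‖(1 + s)⁻¹ * f s‖)) hU
    (Eventually.of_forall fun z => by fun_prop) (integrable_inv_add_mul hν hfm hf hz₀)
    (by fun_prop) ?_ ((hf.norm.const_mul K).const_mul K)
    ?_).2.differentiableAt.differentiableWithinAt
  · filter_upwards [hν] with s hs z hz
    have h := (hK z hz s hs.le).2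
    have h1 : (1 + s)⁻¹ ≤ 1 := inv_le_one_of_one_le₀ (by linarith)
    have hpos : 0 < (1 + s)⁻¹ := by positivity
    have hK0 : 0 ≤ K := nonneg_of_mul_nonneg_left ((norm_nonneg _).trans h) hpos
    have h2 : ‖(z + s)⁻¹‖ ≤ K := h.trans (by nlinarith)
    calc ‖-1 / (z + s) ^ 2 * (f s : ℂ)‖ = ‖(z + s)⁻¹‖ * (‖(z + s)⁻¹‖ * ‖f s‖) := by
          rw [norm_mul, norm_real, norm_div, norm_neg, norm_one, norm_pow, norm_inv]
          ring
      _ ≤ K * ((K * (1 + s)⁻¹) * ‖f s‖) := by gcongr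
      _ = K * (K * ‖(1 + s)⁻¹ * f s‖) := by
          rw [norm_mul, Real.norm_of_nonneg hpos.le]; ring
  · filter_upwards [hν] with s hs z hz
    exact (((hasDerivAt_id z).add_const (s : ℂ)).inv (hK z hz s hs.le).1).mul_const _

theorem poisson_kernel_le {ε b r s : ℝ} (hε : 0 < ε) (hs : s ≤ b) (hb : 0 ≤ b) (hr : 0 < r) :
    ε / ((r - s) ^ 2 + ε ^ 2) ≤ (1 + (1 + b) / ε) * (1 + r)⁻¹ := by
  have hD : 0 < (r - s) ^ 2 + ε ^ 2 := by positivity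
  rw [← div_eq_mul_inv, div_le_div_iff₀ hD (by positivity)]
  have h1 : (1 + (1 + b) / ε) * ((r - s) ^ 2 + ε ^ 2)
      = ((r - s) ^ 2 + ε ^ 2) + (1 + b) * (r - s) ^ 2 / ε + (1 + b) * ε := by
    field_simp; ring
  have h2 : 0 ≤ (1 + b) * (r - s) ^ 2 / ε := by positivity
  rw [h1]
  nlinarith [sq_nonneg (r - s - ε)]

theorem integral_poisson_kernel {ε a b r : ℝ} (hε : 0 < ε) (hab : a ≤ b) :
    ∫ s in Set.Ioc a b, ε / ((r - s) ^ 2 + ε ^ 2)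
      = Real.arctan ((b - r) / ε) - Real.arctan ((a - r) / ε) := by
  rw [← intervalIntegral.integral_of_le hab]
  refine intervalIntegral.integral_eq_sub_of_hasDerivAt
    (f := fun s => Real.arctan ((s - r) / ε)) (fun s _ => ?_) ?_
  · have hD : (r - s) ^ 2 + ε ^ 2 ≠ 0 := by positivity
    have hD' : 1 + ((s - r) / ε) ^ 2 ≠ 0 := by positivity
    refine (((hasDerivAt_id' s).sub_const r).div_const ε).arctan.congr_deriv ?_
    field_simp
    ring
  · refine Continuous.intervalIntegrable ?_ _ _
    refine continuous_const.div (by fun_prop) fun s => by positivity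

theorem arctan_sub_arctan_le {ε a b r : ℝ} (hε : 0 < ε) (hε1 : ε ≤ 1) (hb : 0 ≤ b) (hr : 0 < r) :
    Real.arctan ((b - r) / ε) - Real.arctan ((a - r) / ε) ≤ Real.pi * (2 + b) * (1 + r)⁻¹ := by
  have hπ := Real.pi_gt_three
  have ha := Real.neg_pi_div_two_lt_arctan ((a - r) / ε)
  rw [← div_eq_mul_inv]
  rcases lt_or_ge r (b + 1) with h | h
  · have := Real.arctan_lt_pi_div_two ((b - r) / ε)
    rw [le_div_iff₀ (by linarith)]
    nlinarith
  · have hrb : 0 < r - b := by linarith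
    have h0 : (b - r) / ε < 0 := div_neg_of_neg_of_pos (by linarith) hε
    have h1 := Real.arctan_inv_of_neg h0
    have h2 : Real.arctan (-((b - r) / ε)⁻¹) ≤ -((b - r) / ε)⁻¹ := by
      have hpos : 0 ≤ -((b - r) / ε)⁻¹ := by
        rw [neg_nonneg]; exact (inv_lt_zero.2 h0).le
      simpa [Real.tan_arctan] using Real.le_tan (Real.arctan_nonneg.2 hpos)
        (Real.arctan_lt_pi_div_two _)
    rw [Real.arctan_neg] at h2
    have h3 : -((b - r) / ε)⁻¹ ≤ (2 + b) / (1 + r) := by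
      rw [inv_div, ← div_neg, neg_sub, div_le_div_iff₀ hrb (by linarith)]
      nlinarith
    have h4 : (2 + b) / (1 + r) ≤ Real.pi * (2 + b) / (1 + r) := by
      gcongr
      nlinarith
    linarith

theorem tendsto_arctan_sub_arctan {a b r : ℝ} (ha : r ≠ a) (hb : r ≠ b) (hab : a < b) :
    Tendsto (fun ε : ℝ => Real.arctan ((b - r) / ε) - Real.arctan ((a - r) / ε))
      (nhdsWithin 0 (Set.Ioi 0)) (nhds ((Set.Ioc a b).indicator (fun _ => Real.pi) r)) := by
  have hpos : ∀ c : ℝ, 0 < c → Tendsto (fun ε : ℝ => Real.arctan (c / ε))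
      (nhdsWithin 0 (Set.Ioi 0)) (nhds (Real.pi / 2)) := fun c hc =>
    (Real.tendsto_arctan_atTop.mono_right nhdsWithin_le_nhds).comp
      (tendsto_inv_nhdsGT_zero.const_mul_atTop hc)
  have hneg : ∀ c : ℝ, c < 0 → Tendsto (fun ε : ℝ => Real.arctan (c / ε))
      (nhdsWithin 0 (Set.Ioi 0)) (nhds (-(Real.pi / 2))) := fun c hc =>
    (Real.tendsto_arctan_atBot.mono_right nhdsWithin_le_nhds).comp
      (tendsto_inv_nhdsGT_zero.const_mul_atTop_of_neg hc)
  rcases lt_or_gt_of_ne ha with h | h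
  · rw [Set.indicator_of_notMem (by simp; intro; linarith)]
    simpa using (hpos (b - r) (by linarith)).sub (hpos (a - r) (by linarith))
  rcases lt_or_gt_of_ne hb with h' | h'
  · rw [Set.indicator_of_mem (Set.mem_Ioc.2 ⟨h, h'.le⟩)]
    have := (hpos (b - r) (by linarith)).sub (hneg (a - r) (by linarith))
    rwa [sub_neg_eq_add, add_halves] at this
  · rw [Set.indicator_of_notMem (by simp; intro; linarith)]
    simpa using (hneg (b - r) (by linarith)).sub (hneg (a - r) (by linarith))

theorem ae_ne_or_eq_zero_of_setIntegral_singleton {c : ℝ}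
    (hf : Integrable (fun s => (1 + s)⁻¹ * f s) ν) (hc : 0 < c)
    (h : ∫ s in ({c} : Set ℝ), f s ∂ν = 0) : ∀ᵐ r ∂ν, r ≠ c ∨ f r = 0 := by
  by_cases hfc : f c = 0
  · exact Eventually.of_forall fun r => (ne_or_eq r c).imp_right (by rintro rfl; exact hfc)
  have hlt : ν {c} < ⊤ := by
    have := (integrableOn_singleton_iff).1 (hf.integrableOn (s := {c}))
    refine this.resolve_left (enorm_ne_zero.2 (mul_ne_zero (by positivity) hfc))
  rw [integral_singleton, smul_eq_mul] at h
  have h0 : ν {c} = 0 :=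
    (measureReal_eq_zero_iff hlt.ne).1 ((mul_eq_zero.1 h).resolve_right hfc)
  filter_upwards [measure_eq_zero_iff_ae_notMem.1 h0] with r hr using Or.inl hr

theorem integral_Ioc_im_stieltjes [SFinite ν] (hν : ∀ᵐ s ∂ν, 0 < s) (hfm : Measurable f)
    (hf : Integrable (fun s => (1 + s)⁻¹ * f s) ν) {a b ε : ℝ} (ha : 0 < a) (hab : a < b)
    (hε : 0 < ε) :
    ∫ s in Set.Ioc a b, (-∫ r, ((-(s : ℂ) + ε * I) + r)⁻¹ * (f r : ℂ) ∂ν).im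
      = ∫ r, (Real.arctan ((b - r) / ε) - Real.arctan ((a - r) / ε)) * f r ∂ν := by
  have him : ∀ s : ℝ, (-∫ r, ((-(s : ℂ) + ε * I) + r)⁻¹ * (f r : ℂ) ∂ν).im
      = ∫ r, ε / ((r - s) ^ 2 + ε ^ 2) * f r ∂ν := by
    intro s
    have hz : -(s : ℂ) + ε * I ∈ slitPlane := by
      rw [mem_slitPlane_iff]; right; simpa using hε.ne'
    have hint := integrable_inv_add_mul hν hfm hf hz
    rw [← integral_neg]
    refine (imCLM.integral_comp_comm hint.neg).symm.trans (integral_congr_ae ?_)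
    filter_upwards with r
    simp [normSq_apply]
    ring
  simp_rw [him]
  rw [integral_integral_swap]
  · refine integral_congr_ae ?_
    filter_upwards with r
    rw [integral_mul_const, integral_poisson_kernel hε hab.le]
  · have h1 : Integrable (fun _ : ℝ => (1 + (1 + b) / ε)) (volume.restrict (Set.Ioc a b)) :=
      integrable_const _
    refine (h1.mul_prod hf.norm).mono' (Measurable.aestronglyMeasurable ?_) ?_
    · simp only [Function.uncurry_def]
      fun_prop
    · have hs : ∀ᵐ p ∂((volume.restrict (Set.Ioc a b)).prod ν), p.1 ≤ b :=
        Measure.quasiMeasurePreserving_fst.ae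
          ((ae_restrict_mem measurableSet_Ioc).mono fun s hs => hs.2)
      have hr : ∀ᵐ p ∂((volume.restrict (Set.Ioc a b)).prod ν), 0 < p.2 :=
        Measure.quasiMeasurePreserving_snd.ae hν
      filter_upwards [hs, hr] with p hp1 hp2
      rw [Function.uncurry_def, norm_mul, norm_mul, ← mul_assoc,
        Real.norm_of_nonneg (r := ε / _) (by positivity),
        Real.norm_of_nonneg (r := (1 + p.2)⁻¹) (by positivity)]
      gcongr
      exact poisson_kernel_le hε hp1 (by linarith) hp2

/-- Stieltjes inversion for the scalar signed measure `f dν`. -/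
theorem tendsto_integral_Ioc_im_stieltjes [SFinite ν] (hν : ∀ᵐ s ∂ν, 0 < s) (hfm : Measurable f)
    (hf : Integrable (fun s => (1 + s)⁻¹ * f s) ν) {a b : ℝ} (ha : 0 < a) (hab : a < b)
    (hfa : ∫ s in ({a} : Set ℝ), f s ∂ν = 0) (hfb : ∫ s in ({b} : Set ℝ), f s ∂ν = 0) :
    Tendsto (fun ε : ℝ => (1 / Real.pi) *
        ∫ s in Set.Ioc a b, (-∫ r, ((-(s : ℂ) + ε * I) + r)⁻¹ * (f r : ℂ) ∂ν).im)
      (nhdsWithin 0 (Set.Ioi 0)) (nhds (∫ s in Set.Ioc a b, f s ∂ν)) := by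
  have hlim : Tendsto
      (fun ε : ℝ => ∫ r, (Real.arctan ((b - r) / ε) - Real.arctan ((a - r) / ε)) * f r ∂ν)
      (nhdsWithin 0 (Set.Ioi 0))
      (nhds (∫ r, (Set.Ioc a b).indicator (fun _ => Real.pi) r * f r ∂ν)) := by
    refine tendsto_integral_filter_of_dominated_convergence
      (fun r => Real.pi * (2 + b) * ‖(1 + r)⁻¹ * f r‖) ?_ ?_ (hf.norm.const_mul _) ?_
    · exact Eventually.of_forall fun ε => by fun_prop
    · filter_upwards [Ioc_mem_nhdsGT one_pos] with ε hε
      filter_upwards [hν] with r hr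
      have hε0 : 0 < ε := hε.1
      rw [norm_mul, norm_mul, ← mul_assoc, Real.norm_of_nonneg (r := (1 + r)⁻¹) (by positivity),
        Real.norm_of_nonneg]
      · gcongr
        exact arctan_sub_arctan_le hε.1 hε.2 (by linarith) hr
      · rw [sub_nonneg]
        exact Real.arctan_mono (by gcongr)
    · filter_upwards [ae_ne_or_eq_zero_of_setIntegral_singleton hf ha hfa,
        ae_ne_or_eq_zero_of_setIntegral_singleton hf (ha.trans hab) hfb] with r hra hrb
      rcases hra with hra | h0
      · rcases hrb with hrb | h0
        · exact (tendsto_arctan_sub_arctan hra hrb hab).mul_const _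
        · simp [h0]
      · simp [h0]
  have hval : (1 / Real.pi) * ∫ r, (Set.Ioc a b).indicator (fun _ => Real.pi) r * f r ∂ν
      = ∫ s in Set.Ioc a b, f s ∂ν := by
    simp_rw [← Set.indicator_mul_left]
    rw [integral_indicator measurableSet_Ioc, integral_const_mul, one_div,
      inv_mul_cancel_left₀ Real.pi_ne_zero]
  rw [← hval]
  refine (hlim.const_mul _).congr' ?_
  filter_upwards [self_mem_nhdsWithin] with ε hε
  rw [integral_Ioc_im_stieltjes hν hfm hf ha hab hε]

/-- A holomorphic function on the cut plane is determined by its values on the positive axis. -/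
theorem Complex.eqOn_slitPlane_of_eq_ofReal {g h : ℂ → ℂ} (hg : DifferentiableOn ℂ g slitPlane)
    (hh : DifferentiableOn ℂ h slitPlane) (heq : ∀ x : ℝ, 0 < x → g x = h x) :
    Set.EqOn g h slitPlane := by
  refine (hg.analyticOnNhd isOpen_slitPlane).eqOn_of_preconnected_of_frequently_eq
    (hh.analyticOnNhd isOpen_slitPlane)
    (starConvex_one_slitPlane.isPathConnected one_mem_slitPlane).isConnected.isPreconnected
    one_mem_slitPlane ?_
  have ht : Tendsto (fun x : ℝ => (x : ℂ)) (nhdsWithin 1 {1}ᶜ) (nhdsWithin 1 {1}ᶜ) := by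
    refine tendsto_nhdsWithin_iff.2 ⟨?_, ?_⟩
    · exact (continuous_ofReal.tendsto' 1 1 ofReal_one).mono_left nhdsWithin_le_nhds
    · filter_upwards [self_mem_nhdsWithin] with x hx
      simpa using hx
  refine ht.frequently (Eventually.frequently ?_)
  filter_upwards [nhdsWithin_le_nhds (lt_mem_nhds (one_pos : (0 : ℝ) < 1))] with x hx
  exact heq x hx

end StieltjesTransform

/-- Stieltjes inversion for the representing measure of a matrix-valued
complete Bernstein function: if `A(x) = B + x·C + x·∫ (x+s)⁻¹ M(s) μ(ds)` with
`N(ds) = M(s) μ(ds)`, and `a < b` are continuity points of `N`, then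
`N((a,b]) = (1/π) · lim_{ε→0+} ∫_{(a,b]} Im[A₀(−s+iε)/(s−iε)] ds`,
where `A₀(z) = A(z) − B − z·C` (expressed via the analytic continuation `F`). -/
theorem mvCBF_measure_inversion {d : ℕ}
    (A : ℝ → Matrix (Fin d) (Fin d) ℝ) (F : ℂ → Matrix (Fin d) (Fin d) ℂ)
    (hAF : IsMvCBFWith A F)
    (B C : Matrix (Fin d) (Fin d) ℝ) (μ : Measure ℝ) (M : ℝ → Matrix (Fin d) (Fin d) ℝ)
    (hB : B.PosSemidef) (hC : C.PosSemidef)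
    (hμ : (∫⁻ r in Set.Ioi (0:ℝ), ENNReal.ofReal ((1 + r)⁻¹) ∂μ) < ⊤)
    (hMmeas : ∀ i j, Measurable fun s => M s i j)
    (hMpsd : ∀ᵐ s ∂(μ.restrict (Set.Ioi 0)), (M s).PosSemidef)
    (hMbdd : ∃ K : ℝ, ∀ᵐ s ∂(μ.restrict (Set.Ioi 0)), ∀ i j, |M s i j| ≤ K)
    (hrep : ∀ x : ℝ, 0 < x → ∀ i j,
      A x i j = B i j + x * C i j + x * ∫ s in Set.Ioi (0:ℝ), (x + s)⁻¹ * M s i j ∂μ)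
    (a b : ℝ) (hab : 0 < a ∧ a < b)
    (hcont_a : ∀ i j, ∫ s in ({a} : Set ℝ), M s i j ∂μ = 0)
    (hcont_b : ∀ i j, ∫ s in ({b} : Set ℝ), M s i j ∂μ = 0) :
    ∀ i j, Tendsto
      (fun ε : ℝ => (1 / Real.pi) *
        ∫ s in Set.Ioc a b,
          ((F (-(s:ℂ) + (ε:ℂ) * Complex.I) i j - (B i j : ℂ)
              - (-(s:ℂ) + (ε:ℂ) * Complex.I) * (C i j : ℂ)) / ((s:ℂ) - (ε:ℂ) * Complex.I)).im)
      (nhdsWithin 0 (Set.Ioi 0))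
      (nhds (∫ s in Set.Ioc a b, M s i j ∂μ)) := by
  intro i j
  obtain ⟨K, hK⟩ := hMbdd
  set ν := μ.restrict (Set.Ioi (0 : ℝ)) with hνdef
  have hν : ∀ᵐ s ∂ν, 0 < s := ae_restrict_mem measurableSet_Ioi
  have hgm : Measurable fun r : ℝ => (1 + r)⁻¹ := by fun_prop
  have : SFinite ν := sFinite_of_lintegral_ofReal_ne_top hgm
    (by filter_upwards [hν] with r hr; positivity) hμ.ne
  have hg : Integrable (fun r : ℝ => (1 + r)⁻¹) ν := by
    refine ⟨hgm.aestronglyMeasurable, ?_⟩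
    rw [hasFiniteIntegral_iff_ofReal (by filter_upwards [hν] with r hr; positivity)]
    exact hμ
  have hf : Integrable (fun s => (1 + s)⁻¹ * M s i j) ν :=
    hg.mul_bdd (c := K) (hMmeas i j).aestronglyMeasurable
      (by filter_upwards [hK] with s hs using hs i j)
  have hF : Set.EqOn (fun z => F z i j)
      (fun z => B i j + z * C i j + z * ∫ s, (z + s)⁻¹ * (M s i j : ℂ) ∂ν) slitPlane := by
    refine eqOn_slitPlane_of_eq_ofReal (hAF.1 i j) ?_ fun x hx => ?_
    · have := differentiableOn_integral_inv_add_mul hν (hMmeas i j) hf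
      fun_prop
    · simp only [hAF.2.1 x hx, Matrix.map_apply, hrep x hx i j]
      push_cast [← integral_complex_ofReal]
      rfl
  have hrestrict : ∀ t : Set ℝ, MeasurableSet t → t ⊆ Set.Ioi 0 → ν.restrict t = μ.restrict t :=
    fun t ht h => by rw [hνdef, Measure.restrict_restrict ht, Set.inter_eq_left.2 h]
  have hb : 0 < b := hab.1.trans hab.2
  have key := tendsto_integral_Ioc_im_stieltjes hν (hMmeas i j) hf hab.1 hab.2
    (by rw [hrestrict _ (measurableSet_singleton a) (by simpa using hab.1)]; exact hcont_a i j)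
    (by rw [hrestrict _ (measurableSet_singleton b) (by simpa using hb)]; exact hcont_b i j)
  rw [hrestrict _ measurableSet_Ioc fun s hs => hab.1.trans hs.1] at key
  refine key.congr' ?_
  filter_upwards [self_mem_nhdsWithin] with ε (hε : 0 < ε)
  congr 2
  ext s
  have hz : -(s : ℂ) + ε * I ∈ slitPlane := by
    rw [mem_slitPlane_iff]; right; simpa using hε.ne'
  have hne := slitPlane_ne_zero hz
  have hFz := hF hz
  simp only at hFz
  rw [hFz, show (s : ℂ) - ε * I = -(-(s : ℂ) + ε * I) by ring]
  congr 1
  field_simp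
  ring
end
end

section
/- Let B be a d×d complex matrix having no eigenvalue in the interval (−∞,0] of the real axis. Then the matrix Y := (1/π) ∫₀^∞ B·(sI + B)^{-1}·s^{-1/2} ds satisfies Y·Y = B. -/
open MeasureTheory Complex Filter
open scoped Matrix

noncomputable section

/-- The integral square root `(1/π) ∫₀^∞ B (sI + B)⁻¹ s^{-1/2} ds` (defined entrywise). -/
def intSqrt {d : ℕ} (B : Matrix (Fin d) (Fin d) ℂ) : Matrix (Fin d) (Fin d) ℂ :=
  Matrix.of fun i j => (Real.pi : ℂ)⁻¹ *
    ∫ s in Set.Ioi (0:ℝ),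
      (Real.sqrt s)⁻¹ • ((B * ((s : ℂ) • (1 : Matrix (Fin d) (Fin d) ℂ) + B)⁻¹) i j)

namespace IntSqrt

section Weight

/-- The scalar integrand `s^{-1/2} / (1 + s)`. -/
def weight (s : ℝ) : ℝ := (√s)⁻¹ * (1 + s)⁻¹

lemma weight_nonneg {s : ℝ} (hs : 0 < s) : 0 ≤ weight s := by
  unfold weight; positivity

lemma hasDerivAt_two_mul_arctan_sqrt {s : ℝ} (hs : 0 < s) :
    HasDerivAt (fun s => 2 * Real.arctan (√s)) (weight s) s := by
  have h := ((Real.hasDerivAt_sqrt hs.ne').arctan).const_mul 2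
  refine h.congr_deriv ?_
  have : 0 < √s := Real.sqrt_pos.2 hs
  rw [Real.sq_sqrt hs.le, weight]
  field_simp

lemma tendsto_two_mul_arctan_sqrt :
    Tendsto (fun s => 2 * Real.arctan (√s)) atTop (nhds Real.pi) := by
  have h := ((Real.tendsto_arctan_atTop.mono_right nhdsWithin_le_nhds).comp
    Real.tendsto_sqrt_atTop).const_mul 2
  rwa [mul_div_cancel₀ _ two_ne_zero] at h

lemma continuous_two_mul_arctan_sqrt : Continuous (fun s => 2 * Real.arctan (√s)) := by
  fun_prop

lemma integrableOn_weight : IntegrableOn weight (Set.Ioi 0) :=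
  integrableOn_Ioi_deriv_of_nonneg continuous_two_mul_arctan_sqrt.continuousWithinAt
    (fun _ hs => hasDerivAt_two_mul_arctan_sqrt hs) (fun _ hs => weight_nonneg hs)
    tendsto_two_mul_arctan_sqrt

lemma integral_weight : ∫ s in Set.Ioi 0, weight s = Real.pi := by
  rw [integral_Ioi_of_hasDerivAt_of_tendsto continuous_two_mul_arctan_sqrt.continuousWithinAt
    (fun _ hs => hasDerivAt_two_mul_arctan_sqrt hs) integrableOn_weight
    tendsto_two_mul_arctan_sqrt]
  simp

lemma integrableOn_of_norm_le_weight {E : Type*} [NormedAddCommGroup E] {g : ℝ → E} (K : ℝ)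
    (hg : ContinuousOn g (Set.Ioi 0)) (hK : ∀ s, 0 < s → ‖g s‖ ≤ K * weight s) :
    IntegrableOn g (Set.Ioi 0) :=
  (integrableOn_weight.const_mul K).mono' (hg.aestronglyMeasurable measurableSet_Ioi)
    ((ae_restrict_iff' measurableSet_Ioi).2 (.of_forall hK))

end Weight

section Resolvent

variable {A : Type*} [NormedRing A] [NormedAlgebra ℝ A]

lemma norm_inv_sqrt_smul_mul_mul_le {x c : A} {C s : ℝ} (hC : 0 ≤ C) (hs : 0 < s)
    (hx : ‖x‖ ≤ C * (1 + s)⁻¹) : ‖(√s)⁻¹ • (x * c * x)‖ ≤ (C * ‖c‖ * C) * weight s := by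
  have h2 : (1 + s)⁻¹ ≤ 1 := inv_le_one_of_one_le₀ (by linarith)
  rw [norm_smul, Real.norm_of_nonneg (by positivity), weight]
  calc (√s)⁻¹ * ‖x * c * x‖ ≤ (√s)⁻¹ * ((C * (1 + s)⁻¹) * ‖c‖ * (C * 1)) := by
        gcongr
        refine (norm_mul_le _ _).trans ?_
        gcongr
        · refine (norm_mul_le _ _).trans ?_
          gcongr
        · exact hx.trans (by gcongr)
    _ = _ := by ring

/-- The inverse of `s + (1 + u c)`. -/
def res (c : A) (s u : ℝ) : A := Ring.inverse ((1 + s) • (1 : A) + u • c)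

variable {c : A}

lemma ringInverse_eq_of_mul_eq_one {M : Type*} [MonoidWithZero M] {x y : M} (hx : IsUnit x)
    (hxy : x * y = 1) : Ring.inverse x = y :=
  hx.mul_left_cancel ((Ring.mul_inverse_cancel x hx).trans hxy.symm)

lemma isUnit_add (h : ∀ w ∈ Set.Icc (0 : ℝ) 1, IsUnit ((1 : A) + w • c)) {s u : ℝ} (hs : 0 ≤ s)
    (hu : u ∈ Set.Icc (0 : ℝ) 1) : IsUnit ((1 + s) • (1 : A) + u • c) := by
  have h1 : 0 < 1 + s := by linarith
  have h2 := h (u / (1 + s)) ⟨div_nonneg hu.1 h1.le, (div_le_one h1).2 (by linarith [hu.2])⟩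
  have h3 : (1 + s) • (1 : A) + u • c = (algebraMap ℝ A (1 + s)) * (1 + (u / (1 + s)) • c) := by
    rw [← Algebra.smul_def, smul_add, smul_smul, mul_div_cancel₀ _ h1.ne']
  rw [h3]
  exact ((IsUnit.mk0 _ h1.ne').map (algebraMap ℝ A)).mul h2

lemma commute_res (s u : ℝ) : Commute (res c s u) c := by
  have h : Commute ((1 + s) • (1 : A) + u • c) c :=
    ((Commute.one_left c).smul_left _).add_left ((Commute.refl c).smul_left _)
  rw [res]
  by_cases hx : IsUnit ((1 + s) • (1 : A) + u • c)
  · obtain ⟨x, hx⟩ := hx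
    rw [← hx] at h ⊢
    rw [Ring.inverse_unit]
    exact h.units_inv_left
  · rw [Ring.inverse_non_unit _ hx]
    exact Commute.zero_left c

lemma res_mul (h : ∀ w ∈ Set.Icc (0 : ℝ) 1, IsUnit ((1 : A) + w • c)) {s u : ℝ} (hs : 0 ≤ s)
    (hu : u ∈ Set.Icc (0 : ℝ) 1) : res c s u * (1 + u • c) = 1 - s • res c s u := by
  have h1 := Ring.inverse_mul_cancel _ (isUnit_add h hs hu)
  rw [← res] at h1
  refine eq_sub_of_add_eq (Eq.trans ?_ h1)
  simp only [add_smul, mul_add, mul_smul_comm, mul_one, one_smul]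
  abel

lemma res_zero_right {s : ℝ} (hs : 0 ≤ s) : res c s 0 = (1 + s)⁻¹ • (1 : A) := by
  have h1 : (1 + s) ≠ 0 := by positivity
  rw [res, zero_smul, add_zero]
  rw [← Algebra.algebraMap_eq_smul_one]
  refine ringInverse_eq_of_mul_eq_one ((IsUnit.mk0 _ h1).map (algebraMap ℝ A)) ?_
  rw [← Algebra.smul_def, smul_smul, mul_inv_cancel₀ h1, one_smul]

variable [CompleteSpace A]

lemma hasDerivAt_ringInverse {f : ℝ → A} {f' : A} {t : ℝ} (hf : HasDerivAt f f' t)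
    (hu : IsUnit (f t)) :
    HasDerivAt (fun t => Ring.inverse (f t))
      (-(Ring.inverse (f t) * f' * Ring.inverse (f t))) t := by
  obtain ⟨x, hx⟩ := hu
  have h1 := hasFDerivAt_ringInverse (𝕜 := ℝ) x
  rw [hx] at h1
  have h2 := h1.comp_hasDerivAt t hf
  rw [← hx, Ring.inverse_unit]
  exact h2.congr_deriv (by simp)

lemma hasDerivAt_res_left (h : ∀ w ∈ Set.Icc (0 : ℝ) 1, IsUnit ((1 : A) + w • c)) {s u : ℝ}
    (hs : 0 ≤ s) (hu : u ∈ Set.Icc (0 : ℝ) 1) :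
    HasDerivAt (fun s => res c s u) (-(res c s u * res c s u)) s := by
  have h1 : HasDerivAt (fun s : ℝ => (1 + s) • (1 : A) + u • c) ((1 : ℝ) • (1 : A)) s :=
    (((hasDerivAt_id s).const_add 1).smul_const (1 : A)).add_const _
  have h2 := hasDerivAt_ringInverse h1 (isUnit_add h hs hu)
  simpa [res] using h2

lemma hasDerivAt_res_right (h : ∀ w ∈ Set.Icc (0 : ℝ) 1, IsUnit ((1 : A) + w • c)) {s t : ℝ}
    {u : ℝ → ℝ} {u' : ℝ} (hs : 0 ≤ s) (hu : u t ∈ Set.Icc (0 : ℝ) 1) (hu' : HasDerivAt u u' t) :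
    HasDerivAt (fun t => res c s (u t)) (-(u' • (res c s (u t) * c * res c s (u t)))) t := by
  have h1 : HasDerivAt (fun t : ℝ => (1 + s) • (1 : A) + (u t) • c) (u' • c) t :=
    (hu'.smul_const c).const_add _
  have h2 := hasDerivAt_ringInverse h1 (isUnit_add h hs hu)
  simpa [res] using h2

lemma exists_norm_res_le (h : ∀ w ∈ Set.Icc (0 : ℝ) 1, IsUnit ((1 : A) + w • c)) :
    ∃ C, 0 ≤ C ∧ ∀ s u : ℝ, 0 ≤ s → u ∈ Set.Icc (0 : ℝ) 1 → ‖res c s u‖ ≤ C * (1 + s)⁻¹ := by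
  have hc : ContinuousOn (fun w => res c 0 w) (Set.Icc (0 : ℝ) 1) := fun w hw =>
    (hasDerivAt_res_right (u := id) h le_rfl hw (hasDerivAt_id w)).continuousAt.continuousWithinAt
  obtain ⟨C, hC⟩ := isCompact_Icc.exists_bound_of_continuousOn hc
  refine ⟨C, (norm_nonneg _).trans (hC 0 (by simp)), fun s u hs hu => ?_⟩
  have h1 : 0 < 1 + s := by linarith
  have hw : u / (1 + s) ∈ Set.Icc (0 : ℝ) 1 :=
    ⟨div_nonneg hu.1 h1.le, (div_le_one h1).2 (by linarith [hu.2])⟩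
  have h2 : res c s u = (1 + s)⁻¹ • res c 0 (u / (1 + s)) := by
    refine ringInverse_eq_of_mul_eq_one (isUnit_add h hs hu) ?_
    have h3 : (1 + s) • (1 : A) + u • c
        = (1 + s) • ((1 + (0 : ℝ)) • (1 : A) + (u / (1 + s)) • c) := by
      rw [smul_add, smul_smul, smul_smul, mul_div_cancel₀ _ h1.ne']
      simp
    rw [h3, smul_mul_smul_comm, mul_inv_cancel₀ h1.ne', one_smul]
    exact Ring.mul_inverse_cancel _ (isUnit_add h le_rfl hw)
  rw [h2, norm_smul, Real.norm_of_nonneg (by positivity), mul_comm]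
  gcongr
  exact hC _ hw

lemma continuousOn_res (h : ∀ w ∈ Set.Icc (0 : ℝ) 1, IsUnit ((1 : A) + w • c)) {u : ℝ}
    (hu : u ∈ Set.Icc (0 : ℝ) 1) : ContinuousOn (fun s => res c s u) (Set.Ioi 0) := fun _ hs =>
  (hasDerivAt_res_left h (le_of_lt hs) hu).continuousAt.continuousWithinAt

lemma continuousOn_inv_sqrt : ContinuousOn (fun s : ℝ => (√s)⁻¹) (Set.Ioi 0) :=
  Real.continuous_sqrt.continuousOn.inv₀ fun _ h => (Real.sqrt_pos.2 h).ne'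

lemma integrableOn_inv_sqrt_smul_res (h : ∀ w ∈ Set.Icc (0 : ℝ) 1, IsUnit ((1 : A) + w • c))
    {u : ℝ} (hu : u ∈ Set.Icc (0 : ℝ) 1) :
    IntegrableOn (fun s => (√s)⁻¹ • res c s u) (Set.Ioi 0) := by
  obtain ⟨C, hC, hb⟩ := exists_norm_res_le h
  refine integrableOn_of_norm_le_weight C
    (continuousOn_inv_sqrt.smul (continuousOn_res h hu)) fun s hs => ?_
  rw [norm_smul, Real.norm_of_nonneg (by positivity), weight, mul_left_comm]
  gcongr
  exact hb s u hs.le hu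

lemma integrableOn_sqrt_smul_res_sq (h : ∀ w ∈ Set.Icc (0 : ℝ) 1, IsUnit ((1 : A) + w • c))
    {u : ℝ} (hu : u ∈ Set.Icc (0 : ℝ) 1) :
    IntegrableOn (fun s => √s • (res c s u * res c s u)) (Set.Ioi 0) := by
  obtain ⟨C, hC, hb⟩ := exists_norm_res_le h
  refine integrableOn_of_norm_le_weight (C * C)
    (Real.continuous_sqrt.continuousOn.smul
      ((continuousOn_res h hu).mul (continuousOn_res h hu))) fun s hs => ?_
  have h1 := hb s u hs.le hu
  have h0 : 0 < √s := Real.sqrt_pos.2 hs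
  calc ‖√s • (res c s u * res c s u)‖ ≤ √s * ((C * (1 + s)⁻¹) * (C * (1 + s)⁻¹)) := by
        rw [norm_smul, Real.norm_of_nonneg (by positivity)]
        gcongr
        exact (norm_mul_le _ _).trans (by gcongr)
    _ = (C * C) * ((√s)⁻¹ * (1 + s)⁻¹ * (s * (1 + s)⁻¹)) := by
        have h2 : √s = (√s)⁻¹ * s := by
          rw [inv_mul_eq_div, Real.div_sqrt]
        nth_rewrite 1 [h2]
        ring
    _ ≤ C * C * weight s := by
        rw [weight]
        refine mul_le_mul_of_nonneg_left (mul_le_of_le_one_right (by positivity) ?_) (by positivity)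
        rw [← div_eq_mul_inv, div_le_one (by positivity)]
        linarith

lemma tendsto_sqrt_mul_inv : Tendsto (fun s : ℝ => √s * (1 + s)⁻¹) atTop (nhds 0) := by
  refine squeeze_zero' ((eventually_gt_atTop 0).mono fun s hs => by positivity) ?_
    (tendsto_inv_atTop_zero.comp Real.tendsto_sqrt_atTop)
  refine (eventually_gt_atTop 0).mono fun s hs => ?_
  have h0 : 0 < √s := Real.sqrt_pos.2 hs
  rw [Function.comp, ← div_eq_mul_inv, inv_eq_one_div, div_le_div_iff₀ (by positivity) h0,
    Real.mul_self_sqrt hs.le]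
  linarith

lemma integral_sqrt_smul_res_sq (h : ∀ w ∈ Set.Icc (0 : ℝ) 1, IsUnit ((1 : A) + w • c))
    {u : ℝ} (hu : u ∈ Set.Icc (0 : ℝ) 1) :
    ∫ s in Set.Ioi 0, √s • (res c s u * res c s u)
      = (1 / 2 : ℝ) • ∫ s in Set.Ioi 0, (√s)⁻¹ • res c s u := by
  obtain ⟨C, hC, hb⟩ := exists_norm_res_le h
  have hi1 : IntegrableOn (fun s => (1 / 2 : ℝ) • ((√s)⁻¹ • res c s u)) (Set.Ioi 0) :=
    (integrableOn_inv_sqrt_smul_res h hu).smul (1 / 2 : ℝ)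
  have hi2 := integrableOn_sqrt_smul_res_sq h hu
  have key := integral_Ioi_of_hasDerivAt_of_tendsto (f := fun s => √s • res c s u) (a := 0)
    (m := 0) (f' := fun s => (1 / 2 : ℝ) • ((√s)⁻¹ • res c s u) - √s • (res c s u * res c s u))
    (Real.continuous_sqrt.continuousAt.smul
      (hasDerivAt_res_left h le_rfl hu).continuousAt).continuousWithinAt
    (fun _ hs => by
      have h1 := (Real.hasDerivAt_sqrt (ne_of_gt hs)).smul
        (hasDerivAt_res_left h (le_of_lt hs) hu)
      refine h1.congr_deriv ?_
      rw [smul_smul, smul_neg, one_div, one_div, mul_inv]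
      abel)
    (hi1.sub hi2)
    (by
      refine squeeze_zero_norm' ?_ (by simpa using tendsto_sqrt_mul_inv.const_mul C)
      refine (eventually_gt_atTop 0).mono fun s hs => ?_
      rw [norm_smul, Real.norm_of_nonneg (by positivity), mul_left_comm]
      gcongr
      exact hb s u hs.le hu)
  rw [integral_sub hi1 hi2, integral_smul] at key
  rw [Real.sqrt_zero, zero_smul, sub_zero, sub_eq_zero] at key
  exact key.symm

lemma integrableOn_inv_sqrt_smul_res_mul_mul_res
    (h : ∀ w ∈ Set.Icc (0 : ℝ) 1, IsUnit ((1 : A) + w • c)) {u : ℝ}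
    (hu : u ∈ Set.Icc (0 : ℝ) 1) :
    IntegrableOn (fun s => (√s)⁻¹ • (res c s u * c * res c s u)) (Set.Ioi 0) := by
  obtain ⟨C, hC, hb⟩ := exists_norm_res_le h
  exact integrableOn_of_norm_le_weight (C * ‖c‖ * C)
    (continuousOn_inv_sqrt.smul
      (((continuousOn_res h hu).mul continuousOn_const).mul (continuousOn_res h hu)))
    fun s hs => norm_inv_sqrt_smul_mul_mul_le hC hs (hb s u hs.le hu)

lemma commute_integral_res (h : ∀ w ∈ Set.Icc (0 : ℝ) 1, IsUnit ((1 : A) + w • c)) {u : ℝ}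
    (hu : u ∈ Set.Icc (0 : ℝ) 1) :
    Commute (∫ s in Set.Ioi 0, (√s)⁻¹ • res c s u) c := by
  have hi := integrableOn_inv_sqrt_smul_res h hu
  rw [commute_iff_eq, ← integral_mul_const_of_integrable hi, ← integral_const_mul_of_integrable hi]
  congr 1 with s
  exact ((commute_res s u).smul_left _).eq

/-- Integration by parts in the `u`-derivative of `∫ s^{-1/2} (s + 1 + u c)⁻¹ ds`. -/
lemma integral_res_mul_mul_res_mul (h : ∀ w ∈ Set.Icc (0 : ℝ) 1, IsUnit ((1 : A) + w • c))
    {u : ℝ} (hu : u ∈ Set.Icc (0 : ℝ) 1) :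
    (∫ s in Set.Ioi 0, (√s)⁻¹ • (res c s u * c * res c s u)) * (1 + u • c)
      = (1 / 2 : ℝ) • (c * ∫ s in Set.Ioi 0, (√s)⁻¹ • res c s u) := by
  have hi := integrableOn_inv_sqrt_smul_res_mul_mul_res h hu
  have hi1 := integrableOn_inv_sqrt_smul_res h hu
  have hi2 := integrableOn_sqrt_smul_res_sq h hu
  have h1 : ∀ s ∈ Set.Ioi (0 : ℝ), ((√s)⁻¹ • (res c s u * c * res c s u)) * (1 + u • c)
      = c * ((√s)⁻¹ • res c s u - √s • (res c s u * res c s u)) := by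
    intro s hs
    have h2 : (√s)⁻¹ * s = √s := by
      rw [inv_mul_eq_div, Real.div_sqrt]
    rw [smul_mul_assoc, mul_assoc, res_mul h (le_of_lt hs) hu, (commute_res s u).eq, mul_assoc,
      mul_sub, mul_one, mul_smul_comm, ← mul_smul_comm, smul_sub, smul_smul, h2]
  rw [← integral_mul_const_of_integrable hi, setIntegral_congr_fun measurableSet_Ioi h1,
    integral_const_mul_of_integrable
      (f := fun s => (√s)⁻¹ • res c s u - √s • (res c s u * res c s u)) (hi1.sub hi2), integral_sub hi1 hi2,
    integral_sqrt_smul_res_sq h hu, ← mul_smul_comm]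
  congr 1
  module

lemma hasDerivAt_integral_res (h : ∀ w ∈ Set.Icc (0 : ℝ) 1, IsUnit ((1 : A) + w • c))
    {u u' : ℝ → ℝ} (hu : ∀ t, u t ∈ Set.Icc (0 : ℝ) 1) (hu' : ∀ t, HasDerivAt u (u' t) t)
    {K : ℝ} (hK : ∀ t, |u' t| ≤ K) (t : ℝ) :
    HasDerivAt (fun t => ∫ s in Set.Ioi 0, (√s)⁻¹ • res c s (u t))
      (-(u' t • ∫ s in Set.Ioi 0, (√s)⁻¹ • (res c s (u t) * c * res c s (u t)))) t := by
  obtain ⟨C, hC, hb⟩ := exists_norm_res_le h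
  have hK0 : 0 ≤ K := (abs_nonneg _).trans (hK t)
  have key := (hasDerivAt_integral_of_dominated_loc_of_deriv_le
    (μ := volume.restrict (Set.Ioi 0)) (x₀ := t) (s := Set.univ)
    (F := fun t s => (√s)⁻¹ • res c s (u t))
    (F' := fun t s => (√s)⁻¹ • -(u' t • (res c s (u t) * c * res c s (u t))))
    (bound := fun s => (K * (C * ‖c‖ * C)) * weight s) univ_mem
    (.of_forall fun t => (integrableOn_inv_sqrt_smul_res h (hu t)).aestronglyMeasurable)
    (integrableOn_inv_sqrt_smul_res h (hu t))
    ((continuousOn_inv_sqrt.smul ((((continuousOn_res h (hu t)).mul continuousOn_const).mul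
      (continuousOn_res h (hu t))).const_smul (u' t)).neg).aestronglyMeasurable measurableSet_Ioi)
    ?_ (integrableOn_weight.const_mul _) ?_).2
  · refine key.congr_deriv ?_
    rw [← integral_smul, ← integral_neg]
    congr 1 with s
    module
  · refine (ae_restrict_iff' measurableSet_Ioi).2 (.of_forall fun s (hs : 0 < s) t _ => ?_)
    rw [smul_neg, norm_neg, smul_comm, norm_smul, mul_assoc K]
    exact mul_le_mul (hK t) (norm_inv_sqrt_smul_mul_mul_le hC hs (hb s (u t) hs.le (hu t)))
      (norm_nonneg _) hK0
  · refine (ae_restrict_iff' measurableSet_Ioi).2 (.of_forall fun s hs t _ => ?_)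
    exact (hasDerivAt_res_right h (le_of_lt hs) (hu t) (hu' t)).const_smul (√s)⁻¹

/-- `(∫ s^{-1/2} (s + 1 + c)⁻¹ ds)² (1 + c) = π²`: along the path `1 + u c`, `u = sin² t`, the
left-hand side has derivative zero in `t`. -/
theorem integral_res_mul_self (h : ∀ w ∈ Set.Icc (0 : ℝ) 1, IsUnit ((1 : A) + w • c)) :
    (∫ s in Set.Ioi 0, (√s)⁻¹ • res c s 1) * (∫ s in Set.Ioi 0, (√s)⁻¹ • res c s 1) * (1 + c)
      = (Real.pi ^ 2) • (1 : A) := by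
  have hu : ∀ t : ℝ, Real.sin t ^ 2 ∈ Set.Icc (0 : ℝ) 1 := fun t =>
    ⟨sq_nonneg _, Real.sin_sq_le_one t⟩
  have hu' : ∀ t : ℝ, HasDerivAt (fun t => Real.sin t ^ 2) (2 * Real.sin t * Real.cos t) t :=
    fun t => ((Real.hasDerivAt_sin t).pow 2).congr_deriv (by simp)
  have hK : ∀ t : ℝ, |2 * Real.sin t * Real.cos t| ≤ 1 := fun t => by
    rw [← Real.sin_two_mul]; exact Real.abs_sin_le_one _
  set J : ℝ → A := fun t => ∫ s in Set.Ioi 0, (√s)⁻¹ • res c s (Real.sin t ^ 2) with hJ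
  have hD : ∀ t, HasDerivAt (fun t => J t * J t * (1 + (Real.sin t ^ 2) • c)) 0 t := by
    intro t
    have h1 := hasDerivAt_integral_res h hu hu' hK t
    have h2 := integral_res_mul_mul_res_mul h (hu t)
    have h3 : Commute (J t) c := commute_integral_res h (hu t)
    have h4 := (h1.mul h1).mul (((hu' t).smul_const c).const_add (1 : A))
    refine h4.congr_deriv ?_
    have h5 : Commute (J t) (1 + (Real.sin t ^ 2) • c) :=
      (Commute.one_right _).add_right (h3.smul_right _)
    change (_ * J t + J t * _) * _ + J t * J t * _ = _
    rw [add_mul, mul_assoc _ (J t), h5.eq, ← mul_assoc, mul_assoc (J t)]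
    simp only [neg_mul, smul_mul_assoc, h2]
    simp only [mul_neg, mul_smul_comm, ← mul_assoc, h3.eq]
    rw [mul_assoc (J t), h3.eq, ← mul_assoc, h3.eq]
    module
  have hconst := is_const_of_deriv_eq_zero (fun t => (hD t).differentiableAt)
    (fun t => (hD t).deriv) (Real.pi / 2) 0
  have hJ0 : J 0 = Real.pi • (1 : A) := by
    have h1 : ∀ s ∈ Set.Ioi (0 : ℝ), (√s)⁻¹ • res c s (Real.sin 0 ^ 2) = weight s • (1 : A) := by
      intro s hs
      rw [Real.sin_zero, zero_pow two_ne_zero, res_zero_right (le_of_lt hs), smul_smul, weight]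
    rw [hJ, ← integral_weight, ← integral_smul_const]
    exact setIntegral_congr_fun measurableSet_Ioi h1
  have hJ1 : J (Real.pi / 2) = ∫ s in Set.Ioi 0, (√s)⁻¹ • res c s 1 := by simp [hJ]
  simpa [hJ0, hJ1, smul_smul, pow_two] using hconst

end Resolvent

section Matrix

attribute [local instance] Matrix.linftyOpNormedRing Matrix.linftyOpNormedAlgebra

variable {d : ℕ} {B : Matrix (Fin d) (Fin d) ℂ}

lemma isUnit_one_add_smul (hB : ∀ c ∈ spectrum ℂ B, c ∈ Complex.slitPlane) (w : ℝ)
    (hw : w ∈ Set.Icc (0 : ℝ) 1) : IsUnit (1 + w • (B - 1)) := by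
  rcases hw.1.eq_or_lt with rfl | h0
  · simp
  have h1 : ((-((1 - w) / w) : ℝ) : ℂ) ∉ spectrum ℂ B := fun hmem => by
    have := hB _ hmem
    rw [Complex.ofReal_mem_slitPlane] at this
    have : 0 ≤ (1 - w) / w := div_nonneg (by linarith [hw.2]) h0.le
    linarith
  rw [spectrum.notMem_iff] at h1
  have h2 : 1 + w • (B - 1)
      = algebraMap ℝ _ (-w) * (algebraMap ℂ _ ((-((1 - w) / w) : ℝ) : ℂ) - B) := by
    rw [← Algebra.smul_def, Algebra.algebraMap_eq_smul_one, Complex.coe_smul, smul_sub (-w),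
      smul_smul, neg_mul_neg, mul_div_cancel₀ _ h0.ne']
    module
  rw [h2]
  exact ((IsUnit.mk0 _ (neg_ne_zero.2 h0.ne')).map _).mul h1

lemma intSqrt_eq (hB : ∀ c ∈ spectrum ℂ B, c ∈ Complex.slitPlane) :
    intSqrt B = Real.pi⁻¹ • (B * ∫ s in Set.Ioi 0, (√s)⁻¹ • res (B - 1) s 1) := by
  have hi := integrableOn_inv_sqrt_smul_res (isUnit_one_add_smul hB) (u := 1) (by simp)
  have hi' := hi.const_mul B
  ext i j
  let L : Matrix (Fin d) (Fin d) ℂ →L[ℝ] ℂ :=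
    LinearMap.toContinuousLinearMap (Matrix.entryLinearMap ℝ ℂ i j)
  rw [← integral_const_mul_of_integrable hi, Matrix.smul_apply]
  have h1 := L.integral_comp_comm hi'
  refine Eq.trans ?_ (congrArg (Real.pi⁻¹ • ·) h1)
  simp only [intSqrt, Matrix.of_apply, Complex.real_smul, Complex.ofReal_inv]
  congr 2 with s
  have h2 : (s : ℂ) • (1 : Matrix (Fin d) (Fin d) ℂ) + B
      = (1 + s) • (1 : Matrix (Fin d) (Fin d) ℂ) + (1 : ℝ) • (B - 1) := by
    rw [Complex.coe_smul]
    module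
  rw [h2, Matrix.nonsing_inv_eq_ringInverse, mul_smul_comm, ← Complex.ofReal_inv,
    ← Complex.real_smul]
  rfl

end Matrix

end IntSqrt

/-- if `B` is a complex `d×d` matrix with no eigenvalue in `(−∞,0]`,
then `Y := (1/π) ∫₀^∞ B (sI + B)⁻¹ s^{-1/2} ds` satisfies `Y·Y = B`. -/
theorem intSqrt_mul_self {d : ℕ} (B : Matrix (Fin d) (Fin d) ℂ)
    (hB : ∀ c ∈ spectrum ℂ B, c ∈ Complex.slitPlane) :
    intSqrt B * intSqrt B = B := by
  let : NormedRing (Matrix (Fin d) (Fin d) ℂ) := Matrix.linftyOpNormedRing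
  let : NormedAlgebra ℝ (Matrix (Fin d) (Fin d) ℂ) := Matrix.linftyOpNormedAlgebra
  have hu := IntSqrt.isUnit_one_add_smul hB
  have h1 := IntSqrt.integral_res_mul_self hu
  have h2 := IntSqrt.commute_integral_res hu (u := 1) (by simp)
  rw [IntSqrt.intSqrt_eq hB]
  set J := ∫ s in Set.Ioi 0, (√s)⁻¹ • IntSqrt.res (B - 1) s 1
  have h3 : Commute J B := by simpa using h2.add_right (Commute.one_right J)
  rw [add_sub_cancel] at h1
  have h4 : B * J * (B * J) = (Real.pi ^ 2) • B := by
    rw [← h3.eq, mul_assoc, ← mul_assoc B, ← h3.eq, ← mul_assoc, ← mul_assoc, h1, smul_mul_assoc,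
      one_mul]
  rw [smul_mul_smul_comm, h4, smul_smul]
  have := Real.pi_ne_zero
  rw [show Real.pi⁻¹ * Real.pi⁻¹ * Real.pi ^ 2 = 1 by field_simp, one_smul]
end
end

section
/- Let B be a d×d complex matrix whose Hermitian real part Re B := (B + B†)/2 is positive definite, and let s > 0. Then B + sI is invertible and the Hermitian real part of B·(B + sI)^{-1} equals U†·(B†B + s·Re B)·U with U := (B + sI)^{-1}; in particular Re[B·(B + sI)^{-1}] is positive definite. -/
open Complex
open scoped ComplexOrder Matrix

noncomputable section

/-- The Hermitian "real part" `(X + Xᴴ)/2` of a complex square matrix. -/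
def Matrix.reP {d : ℕ} (X : Matrix (Fin d) (Fin d) ℂ) : Matrix (Fin d) (Fin d) ℂ :=
  (2 : ℂ)⁻¹ • (X + Xᴴ)

namespace Matrix

variable {d : ℕ}

theorem reP_add_real_smul_one (B : Matrix (Fin d) (Fin d) ℂ) (s : ℝ) :
    (B + (s : ℂ) • (1 : Matrix (Fin d) (Fin d) ℂ)).reP = B.reP + (s : ℂ) • 1 := by
  simp only [reP, conjTranspose_add, conjTranspose_smul, conjTranspose_one, RCLike.star_def,
    conj_ofReal]
  module

theorem reP_conjTranspose_add_real_smul_one_mul (B : Matrix (Fin d) (Fin d) ℂ) (s : ℝ) :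
    ((B + (s : ℂ) • (1 : Matrix (Fin d) (Fin d) ℂ))ᴴ * B).reP = Bᴴ * B + (s : ℂ) • B.reP := by
  simp only [reP, conjTranspose_mul, conjTranspose_conjTranspose, conjTranspose_add,
    conjTranspose_smul, conjTranspose_one, RCLike.star_def, conj_ofReal, add_mul,
    smul_mul_assoc, one_mul]
  module

theorem reP_conjTranspose_mul_mul (U X : Matrix (Fin d) (Fin d) ℂ) :
    (Uᴴ * X * U).reP = Uᴴ * X.reP * U := by
  simp only [reP, conjTranspose_mul, conjTranspose_conjTranspose, mul_smul_comm, smul_mul_assoc,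
    mul_add, add_mul, mul_assoc]

/-- A complex matrix with positive definite Hermitian part is invertible. -/
theorem isUnit_of_posDef_reP {M : Matrix (Fin d) (Fin d) ℂ} (hM : M.reP.PosDef) : IsUnit M := by
  rw [← mulVec_injective_iff_isUnit, ← coe_mulVecLin, injective_iff_map_eq_zero]
  intro x hx
  rw [mulVecLin_apply] at hx
  by_contra h
  have hpos := hM.dotProduct_mulVec_pos h
  have hx' : star x ᵥ* Mᴴ = 0 := by rw [← star_mulVec, hx, star_zero]
  simp [reP, smul_mulVec, add_mulVec, hx, dotProduct_mulVec, hx'] at hpos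

end Matrix

/-- if `Re B` is positive definite and `s > 0`, then `B + sI` is invertible,
`Re[B·(B + sI)⁻¹] = Uᴴ·(BᴴB + s·Re B)·U` with `U = (B + sI)⁻¹`, and in particular
`Re[B·(B + sI)⁻¹]` is positive definite. -/
theorem reP_mul_resolvent {d : ℕ} (B : Matrix (Fin d) (Fin d) ℂ)
    (hB : (B.reP).PosDef) (s : ℝ) (hs : 0 < s) :
    IsUnit (B + (s : ℂ) • (1 : Matrix (Fin d) (Fin d) ℂ)) ∧
    (B * (B + (s : ℂ) • 1)⁻¹).reP =
      ((B + (s : ℂ) • 1)⁻¹)ᴴ * (Bᴴ * B + (s : ℂ) • B.reP) * (B + (s : ℂ) • 1)⁻¹ ∧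
    ((B * (B + (s : ℂ) • 1)⁻¹).reP).PosDef := by
  have hA : (B + (s : ℂ) • (1 : Matrix (Fin d) (Fin d) ℂ)).reP.PosDef := by
    rw [Matrix.reP_add_real_smul_one]
    exact hB.add (Matrix.PosDef.one.smul (by exact_mod_cast hs))
  have hunit := Matrix.isUnit_of_posDef_reP hA
  have hform : (B * (B + (s : ℂ) • 1)⁻¹).reP =
      ((B + (s : ℂ) • 1)⁻¹)ᴴ * (Bᴴ * B + (s : ℂ) • B.reP) * (B + (s : ℂ) • 1)⁻¹ := by
    rw [← Matrix.reP_conjTranspose_add_real_smul_one_mul, ← Matrix.reP_conjTranspose_mul_mul,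
      ← mul_assoc, ← Matrix.conjTranspose_mul,
      Matrix.mul_nonsing_inv _ ((Matrix.isUnit_iff_isUnit_det _).mp hunit),
      Matrix.conjTranspose_one, one_mul]
  refine ⟨hunit, hform, ?_⟩
  rw [hform]
  refine Matrix.PosDef.conjTranspose_mul_mul_same ?_
    (Matrix.mulVec_injective_of_isUnit ((Matrix.isUnit_nonsing_inv_iff).mpr hunit))
  exact Matrix.PosDef.posSemidef_add (Matrix.posSemidef_conjTranspose_mul_self B)
    (hB.smul (by exact_mod_cast hs))
end
end

section
/- Let B be a d×d complex matrix whose Hermitian real part Re B := (B + B†)/2 is positive definite. Then the matrix Y := (1/π) ∫₀^∞ B·(sI + B)^{-1}·s^{-1/2} ds is the principal square root of B, i.e. Y² = B and every eigenvalue of Y lies in the open right half-plane; moreover Re Y is positive definite. -/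
open MeasureTheory Complex
open scoped ComplexOrder Matrix

noncomputable section

open Filter Topology

section WeightIntegral

theorem integrableOn_inv_sqrt_mul_inv_add_one :
    IntegrableOn (fun s : ℝ => (√s)⁻¹ * (s + 1)⁻¹) (Set.Ioi 0) ∧
      ∫ s in Set.Ioi (0 : ℝ), (√s)⁻¹ * (s + 1)⁻¹ = Real.pi := by
  have hcont : ContinuousWithinAt (fun s : ℝ => 2 * Real.arctan √s) (Set.Ici 0) 0 := by
    fun_prop
  have hderiv : ∀ s ∈ Set.Ioi (0 : ℝ),
      HasDerivAt (fun s : ℝ => 2 * Real.arctan √s) ((√s)⁻¹ * (s + 1)⁻¹) s := by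
    intro s hs
    have hs' : (0 : ℝ) < s := hs
    have hsq : 0 < √s := Real.sqrt_pos.2 hs'
    refine (((Real.hasDerivAt_sqrt hs'.ne').arctan).const_mul 2).congr_deriv ?_
    rw [Real.sq_sqrt hs'.le]
    field_simp
    ring
  have hnonneg : ∀ s ∈ Set.Ioi (0 : ℝ), 0 ≤ (√s)⁻¹ * (s + 1)⁻¹ := by
    intro s hs
    have hs' : (0 : ℝ) < s := hs
    positivity
  have hlim : Tendsto (fun s : ℝ => 2 * Real.arctan √s) atTop (𝓝 Real.pi) := by
    have h := (tendsto_nhds_of_tendsto_nhdsWithin Real.tendsto_arctan_atTop).comp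
      Real.tendsto_sqrt_atTop
    simpa [mul_div_cancel₀] using h.const_mul 2
  refine ⟨integrableOn_Ioi_deriv_of_nonneg hcont hderiv hnonneg hlim, ?_⟩
  rw [integral_Ioi_of_hasDerivAt_of_nonneg hcont hderiv hnonneg hlim]
  simp

theorem integrableOn_inv_sqrt_mul_inv_add {ε : ℝ} (hε : 0 < ε) :
    IntegrableOn (fun s : ℝ => (√s)⁻¹ * (s + ε)⁻¹) (Set.Ioi 0) := by
  refine Integrable.mono' (integrableOn_inv_sqrt_mul_inv_add_one.1.const_mul (1 + ε⁻¹)) ?_ ?_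
  · refine ContinuousOn.aestronglyMeasurable (fun s hs => ?_) measurableSet_Ioi
    have hs' : (0 : ℝ) < s := hs
    have h1 : √s ≠ 0 := (Real.sqrt_pos.2 hs').ne'
    have h2 : s + ε ≠ 0 := by positivity
    exact ContinuousAt.continuousWithinAt (by fun_prop (disch := assumption))
  · filter_upwards [self_mem_ae_restrict measurableSet_Ioi] with s hs
    have hs' : (0 : ℝ) < s := hs
    rw [Real.norm_of_nonneg (by positivity), mul_left_comm]
    gcongr
    rw [inv_le_iff_one_le_mul₀ (by positivity)]
    field_simp
    nlinarith [mul_pos hs' hε]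

end WeightIntegral

section Resolvent

variable {A : Type*} [NormedRing A] [NormedAlgebra ℝ A]

/-- The resolvent `(s + b)⁻¹`. -/
def shiftInv (b : A) (s : ℝ) : A := Ring.inverse (s • (1 : A) + b)

/-- Every `s + b` with `s ≥ 0` is invertible, with inverse bounded by `(s + ε)⁻¹`. -/
structure ResolventBound (b : A) (ε : ℝ) : Prop where
  pos : 0 < ε
  isUnit : ∀ s : ℝ, 0 ≤ s → IsUnit (s • (1 : A) + b)
  norm_le : ∀ s : ℝ, 0 ≤ s → ‖shiftInv b s‖ ≤ (s + ε)⁻¹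

/-- The integral of `s^{-1/2} (s + b)⁻¹`. -/
def resolventIntegral (b : A) : A := ∫ s in Set.Ioi (0 : ℝ), (√s)⁻¹ • shiftInv b s

/-- The integral of `s^{-1/2} (s + b)⁻²`. -/
def resolventSqIntegral (b : A) : A :=
  ∫ s in Set.Ioi (0 : ℝ), (√s)⁻¹ • (shiftInv b s * shiftInv b s)

variable {b x : A} {ε s : ℝ}

namespace ResolventBound

theorem mul_shiftInv (h : ResolventBound b ε) (hs : 0 ≤ s) :
    b * shiftInv b s = 1 - s • shiftInv b s := by
  have h1 := Ring.mul_inverse_cancel _ (h.isUnit s hs)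
  rw [add_mul, smul_mul_assoc, one_mul] at h1
  exact eq_sub_of_add_eq' h1

theorem commute_shiftInv (h : ResolventBound b ε) (hx : Commute x b) (hs : 0 ≤ s) :
    Commute x (shiftInv b s) := by
  obtain ⟨u, hu⟩ := h.isUnit s hs
  rw [shiftInv, ← hu, Ring.inverse_unit]
  refine Commute.units_inv_right ?_
  rw [hu]
  exact ((Commute.one_right x).smul_right s).add_right hx

theorem norm_shiftInv_mul_mul_le (h : ResolventBound b ε) (x : A) (hs : 0 ≤ s) :
    ‖shiftInv b s * x * shiftInv b s‖ ≤ ε⁻¹ * ‖x‖ * (s + ε)⁻¹ := by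
  have hε := h.pos
  have h1 := h.norm_le s hs
  have h2 : (s + ε)⁻¹ ≤ ε⁻¹ := by gcongr; linarith
  exact norm_mul₃_le.trans (by gcongr; exact h1.trans h2)

theorem aestronglyMeasurable_inv_sqrt_smul {f : ℝ → A} (hf : ContinuousOn f (Set.Ici 0)) :
    AEStronglyMeasurable (fun s : ℝ => (√s)⁻¹ • f s) (volume.restrict (Set.Ioi 0)) := by
  refine ContinuousOn.aestronglyMeasurable (ContinuousOn.smul ?_ (hf.mono Set.Ioi_subset_Ici_self))
    measurableSet_Ioi
  exact Real.continuous_sqrt.continuousOn.inv₀ fun s hs => (Real.sqrt_pos.2 hs).ne'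

variable [CompleteSpace A]

theorem add (h : ResolventBound b ε) (hx : ‖x‖ ≤ ε / 2) : ResolventBound (b + x) (ε / 2) := by
  have hε := h.pos
  have hunit : ∀ s : ℝ, 0 ≤ s → IsUnit (s • (1 : A) + (b + x)) := by
    intro s hs
    have h1 : s • (1 : A) + (b + x) = (s • (1 : A) + b) * (1 - -(shiftInv b s * x)) := by
      rw [sub_neg_eq_add, mul_add, mul_one, ← mul_assoc, shiftInv,
        Ring.mul_inverse_cancel _ (h.isUnit s hs), one_mul, add_assoc]
    rw [h1]
    refine (h.isUnit s hs).mul (isUnit_one_sub_of_norm_lt_one ?_)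
    rw [norm_neg]
    calc ‖shiftInv b s * x‖ ≤ ‖shiftInv b s‖ * ‖x‖ := norm_mul_le _ _
      _ ≤ (s + ε)⁻¹ * (ε / 2) := by gcongr; exact h.norm_le s hs
      _ < 1 := by
        rw [inv_mul_lt_iff₀ (by positivity)]
        linarith
  refine ⟨by positivity, hunit, fun s hs => ?_⟩
  have h1 : shiftInv (b + x) s = shiftInv b s - shiftInv b s * x * shiftInv (b + x) s := by
    have e1 := Ring.mul_inverse_cancel _ (hunit s hs)
    have e2 := Ring.inverse_mul_cancel _ (h.isUnit s hs)
    change _ * shiftInv (b + x) s = 1 at e1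
    change shiftInv b s * _ = 1 at e2
    rw [← add_assoc, add_mul] at e1
    rw [eq_sub_iff_add_eq, mul_assoc]
    calc _ = (shiftInv b s * (s • 1 + b)) * shiftInv (b + x) s
          + shiftInv b s * (x * shiftInv (b + x) s) := by rw [e2, one_mul]
      _ = shiftInv b s * ((s • 1 + b) * shiftInv (b + x) s + x * shiftInv (b + x) s) := by
        rw [mul_add (shiftInv b s) (_ * _) (_ * _), ← mul_assoc (shiftInv b s) (_ + _)]
      _ = _ := by rw [e1, mul_one]
  have h2 : ‖shiftInv (b + x) s‖
      ≤ (s + ε)⁻¹ + (s + ε)⁻¹ * (ε / 2) * ‖shiftInv (b + x) s‖ := by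
    have hb := h.norm_le s hs
    calc ‖shiftInv (b + x) s‖
        = ‖shiftInv b s - shiftInv b s * x * shiftInv (b + x) s‖ := by rw [← h1]
      _ ≤ ‖shiftInv b s‖ + ‖shiftInv b s‖ * ‖x‖ * ‖shiftInv (b + x) s‖ :=
        (norm_sub_le _ _).trans (by gcongr; exact norm_mul₃_le)
      _ ≤ _ := by gcongr
  have hpos : 0 < s + ε := by positivity
  have h3 : (s + ε) * ‖shiftInv (b + x) s‖ ≤ 1 + ε / 2 * ‖shiftInv (b + x) s‖ := by
    have := mul_le_mul_of_nonneg_left h2 hpos.le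
    rwa [mul_add, ← mul_assoc, ← mul_assoc, mul_inv_cancel₀ hpos.ne', one_mul] at this
  rw [← one_div, le_div_iff₀ (by positivity)]
  linarith

theorem hasDerivAt_inverse {c : ℝ → A} {c' : A} {t : ℝ} (hc : HasDerivAt c c' t)
    (hu : IsUnit (c t)) :
    HasDerivAt (fun τ => Ring.inverse (c τ)) (-(Ring.inverse (c t) * c' * Ring.inverse (c t))) t := by
  obtain ⟨u, hu⟩ := hu
  have h := hasFDerivAt_ringInverse (𝕜 := ℝ) u
  rw [hu] at h
  refine (h.comp_hasDerivAt t hc).congr_deriv ?_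
  rw [← hu, Ring.inverse_unit]
  simp

theorem hasDerivAt_shiftInv (h : ResolventBound b ε) (hs : 0 ≤ s) :
    HasDerivAt (shiftInv b) (-(shiftInv b s * shiftInv b s)) s := by
  have hc : HasDerivAt (fun τ : ℝ => τ • (1 : A) + b) (1 : A) s := by
    simpa using ((hasDerivAt_id s).smul_const (1 : A)).add_const b
  refine (hasDerivAt_inverse hc (h.isUnit s hs)).congr_deriv ?_
  rw [mul_one, shiftInv]

theorem continuousOn_shiftInv (h : ResolventBound b ε) :
    ContinuousOn (shiftInv b) (Set.Ici 0) := fun _ hs =>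
  (h.hasDerivAt_shiftInv hs).continuousAt.continuousWithinAt

theorem integrableOn_shiftInv (h : ResolventBound b ε) :
    IntegrableOn (fun s : ℝ => (√s)⁻¹ • shiftInv b s) (Set.Ioi 0) := by
  refine Integrable.mono' (integrableOn_inv_sqrt_mul_inv_add h.pos)
    (aestronglyMeasurable_inv_sqrt_smul h.continuousOn_shiftInv) ?_
  filter_upwards [self_mem_ae_restrict measurableSet_Ioi] with s hs
  rw [norm_smul, Real.norm_of_nonneg (by positivity)]
  gcongr
  exact h.norm_le s (le_of_lt hs)

theorem integrableOn_shiftInv_mul_mul (h : ResolventBound b ε) (x : A) :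
    IntegrableOn (fun s : ℝ => (√s)⁻¹ • (shiftInv b s * x * shiftInv b s)) (Set.Ioi 0) := by
  refine Integrable.mono' ((integrableOn_inv_sqrt_mul_inv_add h.pos).const_mul (ε⁻¹ * ‖x‖))
    (aestronglyMeasurable_inv_sqrt_smul
      ((h.continuousOn_shiftInv.mul continuousOn_const).mul h.continuousOn_shiftInv)) ?_
  filter_upwards [self_mem_ae_restrict measurableSet_Ioi] with s hs
  rw [norm_smul, Real.norm_of_nonneg (by positivity), mul_left_comm]
  gcongr
  exact h.norm_shiftInv_mul_mul_le x (le_of_lt hs)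

theorem integrableOn_shiftInv_sq (h : ResolventBound b ε) :
    IntegrableOn (fun s : ℝ => (√s)⁻¹ • (shiftInv b s * shiftInv b s)) (Set.Ioi 0) := by
  simpa using h.integrableOn_shiftInv_mul_mul 1

theorem commute_resolventIntegral (h : ResolventBound b ε) (hx : Commute x b) :
    Commute x (resolventIntegral b) := by
  rw [Commute, SemiconjBy, resolventIntegral, ← integral_const_mul_of_integrable
    h.integrableOn_shiftInv, ← integral_mul_const_of_integrable h.integrableOn_shiftInv]
  refine setIntegral_congr_fun measurableSet_Ioi fun s hs => ?_
  exact ((h.commute_shiftInv hx (le_of_lt hs)).smul_right _).eq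

theorem commute_resolventSqIntegral (h : ResolventBound b ε) (hx : Commute x b) :
    Commute x (resolventSqIntegral b) := by
  rw [Commute, SemiconjBy, resolventSqIntegral, ← integral_const_mul_of_integrable
    h.integrableOn_shiftInv_sq, ← integral_mul_const_of_integrable h.integrableOn_shiftInv_sq]
  refine setIntegral_congr_fun measurableSet_Ioi fun s hs => ?_
  have hc := h.commute_shiftInv hx (le_of_lt hs)
  exact ((hc.mul_right hc).smul_right _).eq

/-- Integration by parts, applied to `2 s^{1/2} (s + b)⁻¹`. -/
theorem two_smul_mul_resolventSqIntegral (h : ResolventBound b ε) :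
    (2 : ℝ) • (b * resolventSqIntegral b) = resolventIntegral b := by
  have hε := h.pos
  have hderiv : ∀ s ∈ Set.Ioi (0 : ℝ), HasDerivAt (fun s : ℝ => (2 * √s) • shiftInv b s)
      ((2 : ℝ) • (b * ((√s)⁻¹ • (shiftInv b s * shiftInv b s))) - (√s)⁻¹ • shiftInv b s) s := by
    intro s hs
    have hs' : (0 : ℝ) < s := hs
    have hq : 0 < √s := Real.sqrt_pos.2 hs'
    have hd := ((Real.hasDerivAt_sqrt hs'.ne').const_mul 2).smul (h.hasDerivAt_shiftInv hs'.le)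
    refine hd.congr_deriv ?_
    rw [mul_smul_comm, ← mul_assoc, h.mul_shiftInv hs'.le, sub_mul, one_mul, smul_mul_assoc]
    have e1 : 2 * (1 / (2 * √s)) = (√s)⁻¹ := by field_simp
    have e2 : (2 : ℝ) * (√s)⁻¹ * s = 2 * √s := by
      field_simp
      rw [Real.sq_sqrt hs'.le]
    rw [e1, smul_neg, ← e2]
    module
  have hfInt₀ : IntegrableOn
      (fun s : ℝ => (2 : ℝ) • (b * ((√s)⁻¹ • (shiftInv b s * shiftInv b s)))) (Set.Ioi 0) :=
    (h.integrableOn_shiftInv_sq.const_mul b).smul (2 : ℝ)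
  have hfInt := hfInt₀.sub h.integrableOn_shiftInv
  have hcont : ContinuousWithinAt (fun s : ℝ => (2 * √s) • shiftInv b s) (Set.Ici 0) 0 :=
    ContinuousWithinAt.smul (by fun_prop) (h.continuousOn_shiftInv 0 Set.self_mem_Ici)
  have hlim : Tendsto (fun s : ℝ => (2 * √s) • shiftInv b s) atTop (𝓝 0) := by
    have hz : Tendsto (fun s : ℝ => 2 * (√s)⁻¹) atTop (𝓝 0) := by
      simpa using (Real.tendsto_sqrt_atTop.inv_tendsto_atTop).const_mul 2
    refine squeeze_zero_norm' ?_ hz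
    filter_upwards [eventually_gt_atTop 0] with s hs
    have hq : 0 < √s := Real.sqrt_pos.2 hs
    rw [norm_smul, Real.norm_of_nonneg (by positivity)]
    calc 2 * √s * ‖shiftInv b s‖ ≤ 2 * √s * (s + ε)⁻¹ := by gcongr; exact h.norm_le s hs.le
      _ ≤ 2 * √s * s⁻¹ := by gcongr; linarith
      _ = 2 * (√s)⁻¹ := by
        have := Real.sq_sqrt hs.le
        field_simp
        linarith
  have key := integral_Ioi_of_hasDerivAt_of_tendsto hcont hderiv hfInt hlim
  rw [integral_sub hfInt₀ h.integrableOn_shiftInv, integral_smul,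
    integral_const_mul_of_integrable h.integrableOn_shiftInv_sq] at key
  simpa [sub_eq_zero, resolventIntegral, resolventSqIntegral] using key

theorem hasDerivAt_resolventIntegral {n : A} {z : ℝ} (h : ResolventBound (b + z • n) ε)
    (hn : Commute n b) :
    HasDerivAt (fun z : ℝ => resolventIntegral (b + z • n))
      (-(n * resolventSqIntegral (b + z • n))) z := by
  have hε := h.pos
  have hball : {w : ℝ | ResolventBound (b + w • n) (ε / 2)} ∈ 𝓝 z := by
    have hc : Tendsto (fun w : ℝ => ‖(w - z) • n‖) (𝓝 z) (𝓝 0) := by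
      have : Continuous (fun w : ℝ => ‖(w - z) • n‖) := by fun_prop
      simpa using this.tendsto z
    filter_upwards [hc.eventually (ge_mem_nhds (half_pos hε))] with w hw
    have := h.add hw
    rwa [add_assoc, ← add_smul, add_sub_cancel] at this
  have key := (hasDerivAt_integral_of_dominated_loc_of_deriv_le (μ := volume.restrict (Set.Ioi 0))
    (F := fun (w : ℝ) (s : ℝ) => (√s)⁻¹ • shiftInv (b + w • n) s)
    (F' := fun (w : ℝ) (s : ℝ) =>
      (√s)⁻¹ • (-(shiftInv (b + w • n) s * n * shiftInv (b + w • n) s)))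
    (bound := fun s => (ε / 2)⁻¹ * ‖n‖ * ((√s)⁻¹ * (s + ε / 2)⁻¹)) hball ?_
    h.integrableOn_shiftInv ?_ ?_
    ((integrableOn_inv_sqrt_mul_inv_add (half_pos hε)).const_mul _) ?_).2
  · refine key.congr_deriv ?_
    rw [resolventSqIntegral, ← integral_const_mul_of_integrable h.integrableOn_shiftInv_sq,
      ← integral_neg]
    refine setIntegral_congr_fun measurableSet_Ioi fun s hs => ?_
    have hc := h.commute_shiftInv (hn.add_right ((Commute.refl n).smul_right z)) (le_of_lt hs)
    simp only [smul_neg, mul_smul_comm]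
    rw [← hc.eq, mul_assoc]
  · filter_upwards [hball] with w hw
    exact hw.integrableOn_shiftInv.aestronglyMeasurable
  · simpa only [smul_neg] using (h.integrableOn_shiftInv_mul_mul n).aestronglyMeasurable.fun_neg
  · filter_upwards [self_mem_ae_restrict measurableSet_Ioi] with s hs w hw
    rw [norm_smul, norm_neg, Real.norm_of_nonneg (by positivity), mul_left_comm]
    gcongr
    exact hw.norm_shiftInv_mul_mul_le n (le_of_lt hs)
  · filter_upwards [self_mem_ae_restrict measurableSet_Ioi] with s hs w hw
    have hc : HasDerivAt (fun w : ℝ => s • (1 : A) + (b + w • n)) n w := by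
      simpa using (((hasDerivAt_id w).smul_const n).const_add b).const_add (s • (1 : A))
    exact (hasDerivAt_inverse hc (hw.isUnit s (le_of_lt hs))).const_smul (√s)⁻¹

theorem hasDerivAt_resolventIntegral_sq_mul {n : A} {z : ℝ} (h : ResolventBound (b + z • n) ε)
    (hn : Commute n b) :
    HasDerivAt (fun z : ℝ => resolventIntegral (b + z • n) * resolventIntegral (b + z • n)
      * (b + z • n)) 0 z := by
  have hJ := h.hasDerivAt_resolventIntegral hn
  have hB : HasDerivAt (fun z : ℝ => b + z • n) n z := by
    simpa using ((hasDerivAt_id z).smul_const n).const_add b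
  refine ((hJ.mul hJ).mul hB).congr_deriv ?_
  simp only [Pi.mul_apply]
  have hnB : Commute n (b + z • n) := hn.add_right ((Commute.refl n).smul_right z)
  have hparts := h.two_smul_mul_resolventSqIntegral
  have hBJ := h.commute_resolventIntegral (Commute.refl _)
  have hBQ := h.commute_resolventSqIntegral (Commute.refl _)
  have hnJ := h.commute_resolventIntegral hnB
  generalize resolventIntegral (b + z • n) = J at *
  generalize resolventSqIntegral (b + z • n) = Q at *
  generalize b + z • n = B at *
  have hQB : Q * B = (2 : ℝ)⁻¹ • J := by
    rw [← hBQ.eq, ← hparts, smul_smul]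
    norm_num
  have e1 : n * Q * J * B = (2 : ℝ)⁻¹ • (n * J * J) := by
    rw [mul_assoc, ← hBJ.eq, ← mul_assoc, mul_assoc n, hQB, mul_smul_comm, smul_mul_assoc]
  have e2 : J * (n * Q) * B = (2 : ℝ)⁻¹ • (n * J * J) := by
    rw [← mul_assoc J n Q, ← hnJ.eq, mul_assoc (n * J), hQB, mul_smul_comm]
  have e3 : J * J * n = n * J * J := by
    rw [mul_assoc, ← hnJ.eq, ← mul_assoc, ← hnJ.eq]
  rw [neg_mul, mul_neg, add_mul, neg_mul, neg_mul, e1, e2, e3]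
  module

theorem resolventIntegral_one (h : ResolventBound (1 : A) ε) :
    resolventIntegral (1 : A) = Real.pi • (1 : A) := by
  rw [resolventIntegral, ← integrableOn_inv_sqrt_mul_inv_add_one.2, ← integral_smul_const]
  refine setIntegral_congr_fun measurableSet_Ioi fun s hs => ?_
  have hs' : (0 : ℝ) < s := hs
  have h1 := h.mul_shiftInv hs'.le
  rw [one_mul, eq_sub_iff_add_eq'] at h1
  have h2 : (s + 1) • shiftInv (1 : A) s = 1 := by rw [add_smul, one_smul, h1]
  have h3 : shiftInv (1 : A) s = (s + 1)⁻¹ • (1 : A) := by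
    rw [eq_inv_smul_iff₀ (by positivity), h2]
  simp only [h3, smul_smul]

theorem resolventIntegral_sq_mul
    (h : ∀ z ∈ Set.Icc (0 : ℝ) 1, ResolventBound (1 + z • (b - 1)) ε) :
    resolventIntegral b * resolventIntegral b * b = (Real.pi ^ 2) • (1 : A) := by
  have hd := fun z hz => (h z hz).hasDerivAt_resolventIntegral_sq_mul (Commute.one_right (b - 1))
  have key := constant_of_has_deriv_right_zero
    (fun z hz => (hd z hz).continuousAt.continuousWithinAt)
    (fun z hz => (hd z (Set.Ico_subset_Icc_self hz)).hasDerivWithinAt) 1 (by simp)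
  have h0 : ResolventBound (1 : A) ε := by simpa using h 0 (by simp)
  simpa [h0.resolventIntegral_one, smul_smul, sq] using key

end ResolventBound

end Resolvent

namespace Matrix

variable {d : ℕ}

/-- The real quadratic form `Re (x† M x)`. -/
def reQuad (x : Fin d → ℂ) : Matrix (Fin d) (Fin d) ℂ →ₗ[ℝ] ℝ where
  toFun M := (star x ⬝ᵥ M *ᵥ x).re
  map_add' M N := by simp [add_mulVec, dotProduct_add]
  map_smul' r M := by simp [smul_mulVec, dotProduct_smul]

theorem reQuad_apply (x : Fin d → ℂ) (M : Matrix (Fin d) (Fin d) ℂ) :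
    reQuad x M = (star x ⬝ᵥ M *ᵥ x).re := rfl

theorem re_star_dotProduct_self (x : Fin d → ℂ) :
    (star x ⬝ᵥ x).re = ‖WithLp.toLp 2 x‖ ^ 2 := by
  rw [← inner_self_eq_norm_sq (𝕜 := ℂ) (WithLp.toLp 2 x), EuclideanSpace.inner_eq_star_dotProduct,
    dotProduct_comm]
  rfl

theorem reQuad_one (x : Fin d → ℂ) : reQuad x 1 = ‖WithLp.toLp 2 x‖ ^ 2 := by
  rw [reQuad_apply, one_mulVec, re_star_dotProduct_self]

theorem dotProduct_reP_mulVec (x : Fin d → ℂ) (X : Matrix (Fin d) (Fin d) ℂ) :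
    star x ⬝ᵥ X.reP *ᵥ x = (reQuad x X : ℂ) := by
  have h : star x ⬝ᵥ Xᴴ *ᵥ x = star (star x ⬝ᵥ X *ᵥ x) := by
    rw [star_dotProduct, star_mulVec, conjTranspose_conjTranspose, dotProduct_mulVec]
  rw [reP, smul_mulVec, dotProduct_smul, add_mulVec, dotProduct_add, h, reQuad_apply, re_eq_add_conj,
    smul_eq_mul, div_eq_inv_mul]
  rfl

theorem reP_posDef_iff {X : Matrix (Fin d) (Fin d) ℂ} :
    X.reP.PosDef ↔ ∀ x : Fin d → ℂ, x ≠ 0 → 0 < reQuad x X := by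
  have hherm : X.reP.IsHermitian := by
    rw [IsHermitian, reP, conjTranspose_smul, conjTranspose_add, conjTranspose_conjTranspose,
      add_comm]
    simp
  rw [posDef_iff_dotProduct_mulVec]
  simp only [dotProduct_reP_mulVec, zero_lt_real, hherm, true_and]

theorem exists_pos_mul_reQuad_one_le {B : Matrix (Fin d) (Fin d) ℂ}
    (hB : ∀ x : Fin d → ℂ, x ≠ 0 → 0 < reQuad x B) :
    ∃ ε : ℝ, 0 < ε ∧ ∀ x, ε * reQuad x 1 ≤ reQuad x B := by
  have hcont : Continuous fun y : EuclideanSpace ℂ (Fin d) => reQuad y.ofLp B := by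
    simp only [reQuad_apply]
    fun_prop
  have hsphere : ∀ x : Fin d → ℂ, x ≠ 0 → (‖WithLp.toLp 2 x‖⁻¹ : ℂ) • WithLp.toLp 2 x ∈
      Metric.sphere (0 : EuclideanSpace ℂ (Fin d)) 1 := by
    intro x hx
    have hn : ‖WithLp.toLp 2 x‖ ≠ 0 := by simpa using hx
    simp [norm_smul, hn]
  obtain hS | hS := (Metric.sphere (0 : EuclideanSpace ℂ (Fin d)) 1).eq_empty_or_nonempty
  · refine ⟨1, one_pos, fun x => ?_⟩
    obtain rfl | hx := eq_or_ne x 0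
    · simp [reQuad_apply]
    · simpa [hS] using hsphere x hx
  obtain ⟨y, hy, hmin⟩ := (isCompact_sphere _ _).exists_isMinOn hS hcont.continuousOn
  refine ⟨reQuad y.ofLp B, hB _ ?_, fun x => ?_⟩
  · intro h
    have : y = 0 := by ext i; simp [h]
    simp [this] at hy
  obtain rfl | hx := eq_or_ne x 0
  · simp [reQuad_apply]
  have hn : ‖WithLp.toLp 2 x‖ ≠ 0 := by simpa using hx
  have h1 := hmin (hsphere x hx)
  have h2 : reQuad ((‖WithLp.toLp 2 x‖⁻¹ : ℂ) • x) B
      = (‖WithLp.toLp 2 x‖ ^ 2)⁻¹ * reQuad x B := by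
    simp only [reQuad_apply, mulVec_smul, star_smul, smul_dotProduct, dotProduct_smul,
      smul_eq_mul, ← mul_assoc]
    rw [← re_ofReal_mul]
    congr 2
    simp [sq]
  rw [reQuad_one]
  simp only [Set.mem_ofPred_eq, WithLp.ofLp_smul, h2] at h1
  rwa [inv_mul_eq_div, le_div_iff₀ (by positivity)] at h1

theorem re_star_dotProduct_le (x y : Fin d → ℂ) :
    (star x ⬝ᵥ y).re ≤ ‖WithLp.toLp 2 x‖ * ‖WithLp.toLp 2 y‖ := by
  have h := re_inner_le_norm (𝕜 := ℂ) (WithLp.toLp 2 x) (WithLp.toLp 2 y)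
  rwa [EuclideanSpace.inner_eq_star_dotProduct, dotProduct_comm] at h

open scoped Matrix.Norms.L2Operator

theorem resolventBound_of_reQuad {B : Matrix (Fin d) (Fin d) ℂ} {ε : ℝ} (hε : 0 < ε)
    (hB : ∀ x, ε * reQuad x 1 ≤ reQuad x B) : ResolventBound B ε := by
  have hlow : ∀ s : ℝ, ∀ x, (s + ε) * ‖WithLp.toLp 2 x‖ ^ 2 ≤ reQuad x (s • 1 + B) := by
    intro s x
    rw [map_add, map_smul, smul_eq_mul, ← reQuad_one, add_mul]
    gcongr
    exact hB x
  have hunit : ∀ s : ℝ, 0 ≤ s → IsUnit (s • (1 : Matrix (Fin d) (Fin d) ℂ) + B) := by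
    intro s hs
    rw [← mulVec_injective_iff_isUnit]
    refine (injective_iff_map_eq_zero (mulVecLin (s • 1 + B))).2 fun x hx => ?_
    rw [mulVecLin_apply] at hx
    have h1 := hlow s x
    rw [reQuad_apply, hx, dotProduct_zero, zero_re] at h1
    have h2 : ‖WithLp.toLp 2 x‖ ^ 2 ≤ 0 := nonpos_of_mul_nonpos_right h1 (by positivity)
    simpa using h2
  refine ⟨hε, hunit, fun s hs => ?_⟩
  rw [cstar_norm_def]
  refine ContinuousLinearMap.opNorm_le_bound _ (by positivity) fun x => ?_
  have h1 := hlow s (shiftInv B s *ᵥ x.ofLp)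
  have h2 : (s • (1 : Matrix (Fin d) (Fin d) ℂ) + B) *ᵥ (shiftInv B s *ᵥ x.ofLp) = x.ofLp := by
    rw [mulVec_mulVec, shiftInv, Ring.mul_inverse_cancel _ (hunit s hs), one_mulVec]
  rw [reQuad_apply, h2] at h1
  have h3 := h1.trans (re_star_dotProduct_le _ _)
  change (s + ε) * ‖toEuclideanCLM (𝕜 := ℂ) (shiftInv B s) x‖ ^ 2
    ≤ ‖toEuclideanCLM (𝕜 := ℂ) (shiftInv B s) x‖ * ‖x‖ at h3
  rw [← div_eq_inv_mul, le_div_iff₀ (by positivity)]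
  by_contra! hlt
  have hpos : 0 < ‖toEuclideanCLM (𝕜 := ℂ) (shiftInv B s) x‖ :=
    pos_of_mul_pos_left ((norm_nonneg x).trans_lt hlt) (by positivity)
  nlinarith [mul_lt_mul_of_pos_left hlt hpos]

theorem resolventBound_segment {B : Matrix (Fin d) (Fin d) ℂ} {ε : ℝ} (hε : 0 < ε)
    (hB : ∀ x, ε * reQuad x 1 ≤ reQuad x B) {z : ℝ} (hz : z ∈ Set.Icc (0 : ℝ) 1) :
    ResolventBound (1 + z • (B - 1)) (min 1 ε) := by
  refine resolventBound_of_reQuad (by positivity) fun x => ?_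
  have h0 : 0 ≤ reQuad x 1 := by rw [reQuad_one]; positivity
  rw [map_add, map_smul, map_sub, smul_eq_mul]
  have h1 := mul_le_mul_of_nonneg_right (min_le_left 1 ε) h0
  have h2 := (mul_le_mul_of_nonneg_right (min_le_right 1 ε) h0).trans (hB x)
  nlinarith [mul_le_mul_of_nonneg_left h1 (sub_nonneg.2 hz.2), mul_le_mul_of_nonneg_left h2 hz.1]

theorem _root_.ResolventBound.intSqrt_eq {B : Matrix (Fin d) (Fin d) ℂ} {ε : ℝ}
    (h : ResolventBound B ε) :
    intSqrt B = Real.pi⁻¹ • (B * resolventIntegral B) := by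
  ext i j
  rw [resolventIntegral, ← integral_const_mul_of_integrable h.integrableOn_shiftInv]
  have key := (LinearMap.toContinuousLinearMap (entryLinearMap ℝ ℂ i j)).integral_comp_comm
    (h.integrableOn_shiftInv.const_mul B)
  have hfInt : (∫ s in Set.Ioi (0 : ℝ), B * (√s)⁻¹ • shiftInv B s) i j
      = ∫ s in Set.Ioi (0 : ℝ), (B * (√s)⁻¹ • shiftInv B s) i j := key.symm
  rw [intSqrt, of_apply, smul_apply, hfInt, real_smul, ofReal_inv]
  congr 1
  refine setIntegral_congr_fun measurableSet_Ioi fun s _ => ?_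
  simp only [mul_smul_comm, smul_apply, shiftInv, nonsing_inv_eq_ringInverse, coe_smul]

theorem reQuad_mul_shiftInv_pos {B : Matrix (Fin d) (Fin d) ℂ} {ε : ℝ}
    (h : ResolventBound B ε) (hB : ∀ x : Fin d → ℂ, x ≠ 0 → 0 < reQuad x B)
    {x : Fin d → ℂ} (hx : x ≠ 0) {s : ℝ} (hs : 0 < s) : 0 < reQuad x (B * shiftInv B s) := by
  have h2 : (s • (1 : Matrix (Fin d) (Fin d) ℂ) + B) *ᵥ (shiftInv B s *ᵥ x) = x := by
    rw [mulVec_mulVec, shiftInv, Ring.mul_inverse_cancel _ (h.isUnit s hs.le), one_mulVec]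
  rw [reQuad_apply, ← mulVec_mulVec]
  generalize shiftInv B s *ᵥ x = y at h2
  have hy : y ≠ 0 := by
    rintro rfl
    exact hx (by rw [← h2, mulVec_zero])
  rw [← h2, add_mulVec, smul_mulVec, one_mulVec, star_add, add_dotProduct, add_re,
    re_star_dotProduct_self, star_smul, smul_dotProduct, star_trivial, smul_re, smul_eq_mul]
  have := mul_pos hs (hB y hy)
  rw [reQuad_apply] at this
  positivity

theorem reQuad_intSqrt_pos {B : Matrix (Fin d) (Fin d) ℂ} {ε : ℝ}
    (h : ResolventBound B ε) (hB : ∀ x : Fin d → ℂ, x ≠ 0 → 0 < reQuad x B)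
    {x : Fin d → ℂ} (hx : x ≠ 0) : 0 < reQuad x (intSqrt B) := by
  have hfInt := h.integrableOn_shiftInv.const_mul B
  have hfIntL : IntegrableOn (fun s : ℝ => reQuad x (B * (√s)⁻¹ • shiftInv B s)) (Set.Ioi 0) :=
    (LinearMap.toContinuousLinearMap (reQuad x)).integrable_comp hfInt
  have key : ∫ s in Set.Ioi (0 : ℝ), reQuad x (B * (√s)⁻¹ • shiftInv B s)
      = reQuad x (∫ s in Set.Ioi (0 : ℝ), B * (√s)⁻¹ • shiftInv B s) :=
    (LinearMap.toContinuousLinearMap (reQuad x)).integral_comp_comm hfInt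
  have hpos : ∀ s ∈ Set.Ioi (0 : ℝ), 0 < reQuad x (B * (√s)⁻¹ • shiftInv B s) := by
    intro s hs
    rw [mul_smul_comm, map_smul, smul_eq_mul]
    exact mul_pos (inv_pos.2 (Real.sqrt_pos.2 hs)) (reQuad_mul_shiftInv_pos h hB hx hs)
  rw [h.intSqrt_eq, map_smul, resolventIntegral,
    ← integral_const_mul_of_integrable h.integrableOn_shiftInv, ← key, smul_eq_mul]
  refine mul_pos (inv_pos.2 Real.pi_pos) ?_
  rw [setIntegral_pos_iff_support_of_nonneg_ae _ hfIntL]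
  · have hsub : Set.Ioi (0 : ℝ) ⊆ Function.support
        (fun s : ℝ => reQuad x (B * (√s)⁻¹ • shiftInv B s)) := fun s hs => (hpos s hs).ne'
    rw [Set.inter_eq_right.2 hsub]
    simp
  · filter_upwards [self_mem_ae_restrict measurableSet_Ioi] with s hs
    exact (hpos s hs).le

theorem re_pos_of_mem_spectrum {X : Matrix (Fin d) (Fin d) ℂ}
    (hX : ∀ x : Fin d → ℂ, x ≠ 0 → 0 < reQuad x X) {c : ℂ} (hc : c ∈ spectrum ℂ X) :
    0 < c.re := by
  rw [← spectrum_toLin', ← Module.End.hasEigenvalue_iff_mem_spectrum] at hc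
  obtain ⟨v, hv⟩ := hc.exists_hasEigenvector
  have h1 : X *ᵥ v = c • v := by simpa using hv.apply_eq_smul
  have h2 := hX v hv.2
  have h3 : star v ⬝ᵥ v = (‖WithLp.toLp 2 v‖ ^ 2 : ℝ) := by
    rw [← re_star_dotProduct_self]
    refine (Complex.ext rfl ?_)
    simpa using (Complex.nonneg_iff.1 (dotProduct_star_self_nonneg v)).2.symm
  rw [reQuad_apply, h1, dotProduct_smul, h3, smul_eq_mul, re_mul_ofReal] at h2
  exact pos_of_mul_pos_left h2 (by positivity)

theorem intSqrt_mul_self {B : Matrix (Fin d) (Fin d) ℂ} {ε : ℝ} (hε : 0 < ε)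
    (hB : ∀ x, ε * reQuad x 1 ≤ reQuad x B) : intSqrt B * intSqrt B = B := by
  have h := resolventBound_of_reQuad hε hB
  have key := ResolventBound.resolventIntegral_sq_mul fun z hz => resolventBound_segment hε hB hz
  have hc := h.commute_resolventIntegral (Commute.refl B)
  rw [h.intSqrt_eq, smul_mul_smul_comm, mul_assoc B, hc.eq, ← mul_assoc (resolventIntegral B), key,
    mul_smul_comm, smul_smul, mul_one]
  have : Real.pi⁻¹ * Real.pi⁻¹ * Real.pi ^ 2 = 1 := by
    field_simp
  rw [this, one_smul]

end Matrix

/-- if `Re B` is positive definite, then the integral square root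
`Y := (1/π) ∫₀^∞ B (sI + B)⁻¹ s^{-1/2} ds` is the principal square root of `B`:
`Y² = B`, every eigenvalue of `Y` lies in the open right half-plane, and moreover
`Re Y` is positive definite. -/
theorem intSqrt_is_principal_sqrt {d : ℕ} (B : Matrix (Fin d) (Fin d) ℂ)
    (hB : (B.reP).PosDef) :
    intSqrt B * intSqrt B = B ∧
    (∀ c ∈ spectrum ℂ (intSqrt B), 0 < c.re) ∧
    ((intSqrt B).reP).PosDef := by
  have hq := Matrix.reP_posDef_iff.1 hB
  obtain ⟨ε, hε, hcoer⟩ := Matrix.exists_pos_mul_reQuad_one_le hq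
  have hpos : ∀ x : Fin d → ℂ, x ≠ 0 → 0 < Matrix.reQuad x (intSqrt B) := fun _ hx =>
    Matrix.reQuad_intSqrt_pos (Matrix.resolventBound_of_reQuad hε hcoer) hq hx
  exact ⟨Matrix.intSqrt_mul_self hε hcoer,
    fun _ hc => Matrix.re_pos_of_mem_spectrum hpos hc, Matrix.reP_posDef_iff.2 hpos⟩
end
end

section
/- Let B be a d×d complex matrix with no eigenvalue in (−∞,0] and with Im B := (B − B†)/(2i) positive semidefinite. Then the integral square root B^{1/2} := (1/π) ∫₀^∞ B·(sI + B)^{-1}·s^{-1/2} ds satisfies: Im(B^{1/2}) is positive semidefinite. -/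
open MeasureTheory Complex
open scoped ComplexOrder Matrix

noncomputable section

open Filter Topology

/-- The entrywise integral of a family of positive semidefinite matrices is positive semidefinite. -/
theorem Matrix.PosSemidef.of_integral {α n : Type*} [Fintype n] [MeasurableSpace α]
    {μ : Measure α} {G : α → Matrix n n ℂ}
    (hint : ∀ i j, Integrable (fun a => G a i j) μ) (hG : ∀ᵐ a ∂μ, (G a).PosSemidef) :
    (Matrix.of fun i j => ∫ a, G a i j ∂μ).PosSemidef := by
  refine Matrix.PosSemidef.of_dotProduct_mulVec_nonneg ?_ fun x => ?_
  · ext i j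
    rw [Matrix.conjTranspose_apply, Matrix.of_apply, Matrix.of_apply, ← starRingEnd_apply,
      ← integral_conj]
    refine integral_congr_ae ?_
    filter_upwards [hG] with a ha using ha.isHermitian.apply i j
  · have hquad : star x ⬝ᵥ (Matrix.of fun i j => ∫ a, G a i j ∂μ) *ᵥ x =
        ∫ a, star x ⬝ᵥ G a *ᵥ x ∂μ := by
      simp only [dotProduct, Matrix.mulVec, Matrix.of_apply]
      rw [integral_finsetSum _ fun i _ => (integrable_finsetSum _ fun j _ =>
        (hint i j).mul_const (x j)).const_mul _]
      refine Finset.sum_congr rfl fun i _ => ?_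
      rw [integral_const_mul, integral_finsetSum _ fun j _ => (hint i j).mul_const (x j)]
      simp only [integral_mul_const]
    rw [hquad]
    refine integral_nonneg_of_ae ?_
    filter_upwards [hG] with a ha using ha.dotProduct_mulVec_nonneg x

/-- If `0 ≤ s` and `sI + B` is invertible, then `B (sI + B)⁻¹` inherits positive
semidefiniteness of the imaginary part from `B`. -/
theorem Matrix.PosSemidef.imP_mul_inv_smul_one_add {d : ℕ} {B : Matrix (Fin d) (Fin d) ℂ}
    (hB : B.imP.PosSemidef) {s : ℝ} (hs : 0 ≤ s)
    (hu : IsUnit ((s : ℂ) • (1 : Matrix (Fin d) (Fin d) ℂ) + B)) :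
    (B * ((s : ℂ) • (1 : Matrix (Fin d) (Fin d) ℂ) + B)⁻¹).imP.PosSemidef := by
  set A := (s : ℂ) • (1 : Matrix (Fin d) (Fin d) ℂ) + B with hA
  have hdet : IsUnit A.det := (Matrix.isUnit_iff_isUnit_det A).mp hu
  have hAR : A * A⁻¹ = 1 := Matrix.mul_nonsing_inv A hdet
  have hRA : (A⁻¹)ᴴ * Aᴴ = 1 := by
    rw [← Matrix.conjTranspose_mul, hAR, Matrix.conjTranspose_one]
  have hBA : B = A - (s : ℂ) • 1 := by simp [hA]
  have hBR : B * A⁻¹ = 1 - (s : ℂ) • A⁻¹ := by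
    conv_lhs => rw [hBA]
    rw [sub_mul, hAR, Matrix.smul_mul, one_mul]
  have hBH : B - Bᴴ = A - Aᴴ := by
    rw [hBA]; simp
  have key : (B * A⁻¹).imP = (s : ℂ) • ((A⁻¹)ᴴ * B.imP * A⁻¹) := by
    have h : (A⁻¹)ᴴ * (A - Aᴴ) * A⁻¹ = (A⁻¹)ᴴ - A⁻¹ := by
      rw [mul_sub, sub_mul, mul_assoc, hAR, mul_one, hRA, one_mul]
    rw [hBR]
    simp only [Matrix.imP]
    rw [hBH, Matrix.mul_smul, Matrix.smul_mul, h, smul_comm]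
    congr 1
    simp only [Matrix.conjTranspose_sub, Matrix.conjTranspose_one, Matrix.conjTranspose_smul,
      RCLike.star_def, Complex.conj_ofReal, smul_sub]
    abel
  rw [key]
  exact (hB.conjTranspose_mul_mul_same _).smul (by exact_mod_cast hs)

/-- If `B` has no eigenvalue in `(−∞,0]`, then `sI + B` is invertible for all `s ≥ 0`. -/
theorem isUnit_smul_one_add_of_spectrum_subset_slitPlane {d : ℕ} {B : Matrix (Fin d) (Fin d) ℂ}
    (hspec : ∀ c ∈ spectrum ℂ B, c ∈ Complex.slitPlane) {s : ℝ} (hs : 0 ≤ s) :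
    IsUnit ((s : ℂ) • (1 : Matrix (Fin d) (Fin d) ℂ) + B) := by
  by_contra h
  have hmem : -(s : ℂ) ∈ spectrum ℂ B := by
    rw [spectrum.mem_iff, Algebra.algebraMap_eq_smul_one]
    intro h'
    apply h
    have h'' := h'.neg
    rwa [neg_sub, neg_smul, sub_neg_eq_add, add_comm] at h''
  have h2 := hspec _ hmem
  rw [← Complex.ofReal_neg, Complex.ofReal_mem_slitPlane] at h2
  linarith

theorem ContinuousAt.matrix_inv {X n : Type*} [TopologicalSpace X] [Fintype n] [DecidableEq n]
    {A : X → Matrix n n ℂ} {x : X} (hA : ContinuousAt A x) (hu : IsUnit (A x)) :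
    ContinuousAt (fun y => (A y)⁻¹) x := by
  refine ContinuousAt.comp (g := Inv.inv) (continuousAt_matrix_inv _ ?_) hA
  have hdet : (A x).det ≠ 0 := ((Matrix.isUnit_iff_isUnit_det _).mp hu).ne_zero
  simpa [Ring.inverse_eq_inv'] using continuousAt_inv₀ hdet

/-- The integrand of `intSqrt` is integrable entrywise. -/
theorem integrableOn_intSqrt_integrand {d : ℕ} {B : Matrix (Fin d) (Fin d) ℂ}
    (hspec : ∀ c ∈ spectrum ℂ B, c ∈ Complex.slitPlane) (i j : Fin d) :
    IntegrableOn (fun s : ℝ => (Real.sqrt s)⁻¹ •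
      ((B * ((s : ℂ) • (1 : Matrix (Fin d) (Fin d) ℂ) + B)⁻¹) i j)) (Set.Ioi 0) := by
  set f : ℝ → ℂ := fun s => (B * ((s : ℂ) • (1 : Matrix (Fin d) (Fin d) ℂ) + B)⁻¹) i j with hf
  have hentry : Continuous fun M : Matrix (Fin d) (Fin d) ℂ => (B * M) i j :=
    (continuous_const.matrix_mul continuous_id).matrix_elem i j
  have hcont : ∀ s : ℝ, 0 ≤ s → ContinuousAt f s := fun s hs =>
    hentry.continuousAt.comp (f := fun t : ℝ => ((t : ℂ) • (1 : Matrix (Fin d) (Fin d) ℂ) + B)⁻¹) <|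
      ContinuousAt.matrix_inv (by fun_prop)
        (isUnit_smul_one_add_of_spectrum_subset_slitPlane hspec hs)
  have htop : f =O[atTop] fun s : ℝ => s ^ (-1 : ℝ) := by
    have hinv : ContinuousAt (fun u : ℝ => (B * (1 + (u : ℂ) • B)⁻¹) i j) 0 :=
      hentry.continuousAt.comp (f := fun u : ℝ => (1 + (u : ℂ) • B)⁻¹) <|
        ContinuousAt.matrix_inv (by fun_prop) (by simp)
    have hlim := (hinv.tendsto.comp tendsto_inv_atTop_zero).isBigO_one ℝ
    have hmul := (Asymptotics.isBigO_refl (fun s : ℝ => s ^ (-1 : ℝ)) atTop).smul hlim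
    refine (hmul.congr' ?_ ?_)
    · filter_upwards [eventually_gt_atTop 0] with s hs
      have hs' : (s : ℂ) ≠ 0 := by exact_mod_cast hs.ne'
      have hfac : (s : ℂ) • (1 : Matrix (Fin d) (Fin d) ℂ) + B =
          (s : ℂ) • (1 + ((s⁻¹ : ℝ) : ℂ) • B) := by
        rw [smul_add, smul_smul, Complex.ofReal_inv, mul_inv_cancel₀ hs', one_smul]
      have hu := isUnit_smul_one_add_of_spectrum_subset_slitPlane hspec hs.le
      rw [hfac] at hu
      have hdet : IsUnit (1 + ((s⁻¹ : ℝ) : ℂ) • B).det := by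
        rw [← Matrix.isUnit_iff_isUnit_det]
        have hu' := hu.smul (Units.mk0 _ (inv_ne_zero hs'))
        rwa [Units.smul_mk0, smul_smul, inv_mul_cancel₀ hs', one_smul] at hu'
      have := invertibleOfNonzero hs'
      simp only [hf, Function.comp_apply]
      rw [hfac, Matrix.inv_smul _ _ hdet, invOf_eq_inv, Matrix.mul_smul, Matrix.smul_apply,
        Real.rpow_neg_one, ← Complex.coe_smul, Complex.ofReal_inv]
    · exact Eventually.of_forall fun s => by simp
  have hzero : f =O[𝓝[>] 0] fun s : ℝ => s ^ (-0 : ℝ) := by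
    simpa using (((hcont 0 le_rfl).tendsto.mono_left nhdsWithin_le_nhds).isBigO_one ℝ)
  have hmellin : MellinConvergent f (1 / 2 : ℂ) :=
    mellinConvergent_of_isBigO_rpow
      ((ContinuousOn.locallyIntegrableOn
        (fun s hs => (hcont s (le_of_lt hs)).continuousWithinAt) measurableSet_Ioi))
      htop (by norm_num) hzero (by norm_num)
  refine IntegrableOn.congr_fun hmellin (fun s hs => ?_) measurableSet_Ioi
  have hs : 0 < s := hs
  have hpow : (s : ℂ) ^ ((1 / 2 : ℂ) - 1) = (((Real.sqrt s)⁻¹ : ℝ) : ℂ) := by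
    rw [Real.sqrt_eq_rpow, ← Real.rpow_neg hs.le, Complex.ofReal_cpow hs.le]
    norm_num
  simp only [hpow]
  exact Complex.coe_smul _ (f s)

/-- if `B` has no eigenvalue in `(−∞,0]` and `Im B` is positive
semidefinite, then `Im(B^{1/2})` is positive semidefinite, where `B^{1/2}` is the
integral square root `(1/π) ∫₀^∞ B (sI + B)⁻¹ s^{-1/2} ds`. -/
theorem imP_intSqrt_posSemidef {d : ℕ} (B : Matrix (Fin d) (Fin d) ℂ)
    (hspec : ∀ c ∈ spectrum ℂ B, c ∈ Complex.slitPlane)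
    (hB : (B.imP).PosSemidef) :
    ((intSqrt B).imP).PosSemidef := by
  set F : ℝ → Matrix (Fin d) (Fin d) ℂ :=
    fun s => B * ((s : ℂ) • (1 : Matrix (Fin d) (Fin d) ℂ) + B)⁻¹ with hF
  have hint : ∀ i j, IntegrableOn (fun s => (Real.sqrt s)⁻¹ • F s i j) (Set.Ioi 0) :=
    integrableOn_intSqrt_integrand hspec
  have hint' : ∀ i j, IntegrableOn (fun s => star ((Real.sqrt s)⁻¹ • F s i j)) (Set.Ioi 0) :=
    fun i j => Complex.conjCLE.toContinuousLinearMap.integrable_comp (hint i j)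
  have hentry : ∀ i j s, ((Real.sqrt s)⁻¹ • (F s).imP) i j =
      (2 * Complex.I)⁻¹ * ((Real.sqrt s)⁻¹ • F s i j - star ((Real.sqrt s)⁻¹ • F s j i)) := by
    intro i j s
    simp only [Matrix.imP, Matrix.smul_apply, Matrix.sub_apply, Matrix.conjTranspose_apply,
      star_smul, star_trivial, smul_eq_mul, ← smul_sub, mul_smul_comm]
  have heq : (intSqrt B).imP = ((Real.pi⁻¹ : ℝ) : ℂ) •
      Matrix.of fun i j => ∫ s in Set.Ioi (0 : ℝ), ((Real.sqrt s)⁻¹ • (F s).imP) i j := by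
    ext i j
    simp only [hentry, Matrix.smul_apply, Matrix.of_apply]
    rw [integral_const_mul, integral_sub (hint i j) (hint' j i)]
    simp only [← starRingEnd_apply]
    rw [integral_conj]
    simp only [Matrix.imP, intSqrt, Matrix.smul_apply, Matrix.sub_apply,
      Matrix.conjTranspose_apply, Matrix.of_apply, smul_eq_mul, ← starRingEnd_apply, map_mul,
      map_inv₀, Complex.conj_ofReal, Complex.ofReal_inv, hF]
    ring
  rw [heq]
  refine Matrix.PosSemidef.smul (Matrix.PosSemidef.of_integral (fun i j => ?_) ?_) ?_
  · simp only [hentry]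
    exact ((hint i j).sub (hint' j i)).const_mul _
  · refine (ae_restrict_iff' measurableSet_Ioi).mpr (Eventually.of_forall fun s hs => ?_)
    exact (hB.imP_mul_inv_smul_one_add (le_of_lt hs)
      (isUnit_smul_one_add_of_spectrum_subset_slitPlane hspec (le_of_lt hs))).smul
        (inv_nonneg.mpr (Real.sqrt_nonneg s))
  · exact_mod_cast inv_nonneg.mpr Real.pi_pos.le
end
end

section
/- Let A : (0,∞) → M_d(ℝ) be a matrix-valued complete Bernstein function whose analytic continuation A(z) to ℂ ∖ (−∞,0] has, for every z in the cut plane, no eigenvalue in (−∞,0]. Then the function x ↦ A(x)^{1/2} (principal square root) on (0,∞) is again a matrix-valued complete Bernstein function. -/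
open MeasureTheory Complex Filter
open scoped ComplexOrder Matrix

noncomputable section

open scoped Matrix.Norms.L2Operator MatrixOrder

/-- The pencil `sin² t + cos² t · X`, which is invertible for real `t` when `X` has no
eigenvalue in `(−∞,0]`. -/
def Matrix.sqrtPencil {d : ℕ} (X : Matrix (Fin d) (Fin d) ℂ) (t : ℝ) : Matrix (Fin d) (Fin d) ℂ :=
  ((Real.sin t : ℂ) ^ 2) • 1 + ((Real.cos t : ℂ) ^ 2) • X

theorem Matrix.isUnit_sqrtPencil {d : ℕ} {X : Matrix (Fin d) (Fin d) ℂ}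
    (hX : ∀ c ∈ spectrum ℂ X, c ∈ Complex.slitPlane) (t : ℝ) : IsUnit (X.sqrtPencil t) := by
  rcases eq_or_ne (Real.cos t) 0 with h | h
  · have hs : Real.sin t ^ 2 = 1 := by
      have := Real.sin_sq_add_cos_sq t
      rw [h] at this; simpa using this
    have hs' : (Real.sin t : ℂ) ^ 2 = 1 := by exact_mod_cast hs
    rw [Matrix.sqrtPencil, hs', h]
    simp
  · have h' : (Real.cos t : ℂ) ^ 2 ≠ 0 := by exact_mod_cast pow_ne_zero 2 h
    have hn : (-((Real.sin t / Real.cos t) ^ 2 : ℝ) : ℂ) ∉ spectrum ℂ X := fun hc => by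
      have := hX _ hc
      rw [← Complex.ofReal_neg, Complex.ofReal_mem_slitPlane] at this
      nlinarith [sq_nonneg (Real.sin t / Real.cos t)]
    have hu := (spectrum.notMem_iff.1 hn).neg
    have e : X.sqrtPencil t = ((Real.cos t : ℂ) ^ 2) •
        (-(algebraMap ℂ _ (-((Real.sin t / Real.cos t) ^ 2 : ℝ) : ℂ) - X)) := by
      rw [Matrix.sqrtPencil, Algebra.algebraMap_eq_smul_one, neg_sub, sub_eq_add_neg, ← neg_smul,
        neg_neg, smul_add, smul_smul, add_comm]
      congr 2
      have : (Real.cos t : ℂ) ≠ 0 := by exact_mod_cast h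
      rw [Complex.ofReal_pow, Complex.ofReal_div]
      field_simp
    rw [e]
    exact hu.smul (Units.mk0 _ h')

theorem differentiableOn_intervalIntegral_of_continuousOn_deriv {E : Type*} [NormedAddCommGroup E]
    [NormedSpace ℂ E] {f f' : ℂ → ℝ → E} {U : Set ℂ} (hU : IsOpen U) {a b : ℝ}
    (hf : ContinuousOn (Function.uncurry f) (U ×ˢ Set.univ))
    (hf' : ContinuousOn (Function.uncurry f') (U ×ˢ Set.univ))
    (hd : ∀ z ∈ U, ∀ t, HasDerivAt (fun w => f w t) (f' z t) z) :
    DifferentiableOn ℂ (fun z => ∫ t in a..b, f z t) U := by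
  intro z hz
  have hslice : ∀ {g : ℂ → ℝ → E}, ContinuousOn (Function.uncurry g) (U ×ˢ Set.univ) →
      ∀ w ∈ U, Continuous (g w) := fun {g} hg w hw =>
    continuousOn_univ.1 (hg.comp (f := fun t => (w, t)) (by fun_prop) fun t _ => ⟨hw, trivial⟩)
  obtain ⟨K, hK, hzK, hKU⟩ := exists_compact_subset hU hz
  obtain ⟨C, hC⟩ := (hK.prod (isCompact_uIcc (a := a) (b := b))).exists_bound_of_continuousOn
    (hf'.mono (Set.prod_mono hKU (Set.subset_univ _)))
  have := intervalIntegral.hasDerivAt_integral_of_dominated_loc_of_deriv_le (μ := volume)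
    (F := f) (F' := f') (a := a) (b := b) (bound := fun _ => C)
    (mem_interior_iff_mem_nhds.1 hzK)
    (by filter_upwards [hU.mem_nhds hz] with w hw using (hslice hf w hw).aestronglyMeasurable)
    ((hslice hf z hz).intervalIntegrable _ _) (hslice hf' z hz).aestronglyMeasurable
    (ae_of_all _ fun t ht w hw => hC (w, t) ⟨hw, Set.uIoc_subset_uIcc ht⟩)
    intervalIntegrable_const
    (ae_of_all _ fun t _ w hw => hd w (hKU hw) t)
  exact this.2.differentiableAt.differentiableWithinAt

/-- The principal square root of `X` as `(2/π) ∫₀^{π/2} X (sin² t + cos² t · X)⁻¹ dt`. -/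
def Matrix.sqrtIntegral {d : ℕ} (X : Matrix (Fin d) (Fin d) ℂ) : Matrix (Fin d) (Fin d) ℂ :=
  (2 / Real.pi : ℝ) • ∫ t in (0 : ℝ)..(Real.pi / 2), X * Ring.inverse (X.sqrtPencil t)

theorem continuousOn_inverse_sqrtPencil {d : ℕ} {F : ℂ → Matrix (Fin d) (Fin d) ℂ} {U : Set ℂ}
    (hF : ContinuousOn F U) (hspec : ∀ z ∈ U, ∀ c ∈ spectrum ℂ (F z), c ∈ Complex.slitPlane) :
    ContinuousOn (fun p : ℂ × ℝ => Ring.inverse ((F p.1).sqrtPencil p.2)) (U ×ˢ Set.univ) := by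
  have hF' : ContinuousOn (fun p : ℂ × ℝ => F p.1) (U ×ˢ Set.univ) :=
    hF.comp continuousOn_fst fun p hp => hp.1
  intro p hp
  obtain ⟨u, hu⟩ := Matrix.isUnit_sqrtPencil (hspec p.1 hp.1) p.2
  refine ContinuousAt.comp_continuousWithinAt (f := fun p : ℂ × ℝ => (F p.1).sqrtPencil p.2)
    (g := Ring.inverse) (hu ▸ NormedRing.inverse_continuousAt u) ?_
  have h1 : Continuous fun p : ℂ × ℝ => (Real.sin p.2 : ℂ) ^ 2 := by fun_prop
  have h2 : Continuous fun p : ℂ × ℝ => (Real.cos p.2 : ℂ) ^ 2 := by fun_prop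
  exact ((h1.smul continuous_const).continuousOn.add (h2.continuousOn.smul hF')) p hp

theorem differentiableOn_sqrtIntegral {d : ℕ} {F : ℂ → Matrix (Fin d) (Fin d) ℂ} {U : Set ℂ}
    (hU : IsOpen U) (hF : DifferentiableOn ℂ F U)
    (hspec : ∀ z ∈ U, ∀ c ∈ spectrum ℂ (F z), c ∈ Complex.slitPlane) :
    DifferentiableOn ℂ (fun z => (F z).sqrtIntegral) U := by
  have hinv := continuousOn_inverse_sqrtPencil hF.continuousOn hspec
  have hF' : ContinuousOn (fun p : ℂ × ℝ => F p.1) (U ×ˢ Set.univ) :=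
    hF.continuousOn.comp continuousOn_fst fun p hp => hp.1
  have hD : ContinuousOn (fun p : ℂ × ℝ => deriv F p.1) (U ×ˢ Set.univ) :=
    (hF.deriv hU).continuousOn.comp continuousOn_fst fun p hp => hp.1
  have hf : ContinuousOn
      (Function.uncurry fun (z : ℂ) (t : ℝ) => F z * Ring.inverse ((F z).sqrtPencil t))
      (U ×ˢ Set.univ) := hF'.mul hinv
  have hcos : ContinuousOn (fun p : ℂ × ℝ => (Real.cos p.2 : ℂ) ^ 2) (U ×ˢ Set.univ) := by
    fun_prop
  have hf' : ContinuousOn (Function.uncurry fun (z : ℂ) (t : ℝ) =>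
      deriv F z * Ring.inverse ((F z).sqrtPencil t) + F z * -(Ring.inverse ((F z).sqrtPencil t) *
        (((Real.cos t : ℂ) ^ 2) • deriv F z) * Ring.inverse ((F z).sqrtPencil t)))
      (U ×ˢ Set.univ) :=
    (hD.mul hinv).add (hF'.mul ((hinv.mul (hcos.smul hD)).mul hinv).neg)
  refine (differentiableOn_intervalIntegral_of_continuousOn_deriv hU hf hf' ?_).const_smul
    (2 / Real.pi : ℝ)
  intro z hz t
  have h1 : HasDerivAt F (deriv F z) z := (hF.differentiableAt (hU.mem_nhds hz)).hasDerivAt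
  refine h1.mul ?_
  obtain ⟨u, hu⟩ := Matrix.isUnit_sqrtPencil (hspec z hz) t
  have h2 : HasDerivAt (fun w => (F w).sqrtPencil t) (((Real.cos t : ℂ) ^ 2) • deriv F z) z :=
    (h1.const_smul ((Real.cos t : ℂ) ^ 2)).const_add
      (((Real.sin t : ℂ) ^ 2) • (1 : Matrix (Fin d) (Fin d) ℂ))
  have h3 := hasFDerivAt_ringInverse (𝕜 := ℂ) u
  rw [hu] at h3
  have := h3.comp_hasDerivAt z h2
  rw [← hu, Ring.inverse_unit]
  exact this.congr_deriv (by simp)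

theorem continuous_inverse_sqrtPencil {d : ℕ} {X : Matrix (Fin d) (Fin d) ℂ}
    (hX : ∀ c ∈ spectrum ℂ X, c ∈ Complex.slitPlane) :
    Continuous fun t : ℝ => Ring.inverse (X.sqrtPencil t) :=
  continuousOn_univ.1 <| (continuousOn_inverse_sqrtPencil (F := fun _ => X) (U := Set.univ)
    continuousOn_const fun _ _ => hX).comp (f := fun t : ℝ => ((0 : ℂ), t)) (by fun_prop)
    fun _ _ => ⟨trivial, trivial⟩

theorem Matrix.imP_mul_inverse_sqrtPencil {d : ℕ} {X : Matrix (Fin d) (Fin d) ℂ}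
    (hX : ∀ c ∈ spectrum ℂ X, c ∈ Complex.slitPlane) (t : ℝ) :
    (X * Ring.inverse (X.sqrtPencil t)).imP = ((Real.sin t : ℂ) ^ 2) •
      ((Ring.inverse (X.sqrtPencil t))ᴴ * X.imP * Ring.inverse (X.sqrtPencil t)) := by
  set M := X.sqrtPencil t with hM
  set N := Ring.inverse M
  have h1 : M * N = 1 := Ring.mul_inverse_cancel _ (Matrix.isUnit_sqrtPencil hX t)
  have h2 : Nᴴ * Mᴴ = 1 := by rw [← conjTranspose_mul, h1, conjTranspose_one]
  have hMH : Mᴴ = ((Real.sin t : ℂ) ^ 2) • 1 + ((Real.cos t : ℂ) ^ 2) • Xᴴ := by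
    simp only [hM, Matrix.sqrtPencil, conjTranspose_add, conjTranspose_smul, conjTranspose_one,
      star_pow, Complex.star_def, Complex.conj_ofReal]
  have key : Mᴴ * X - Xᴴ * M = ((Real.sin t : ℂ) ^ 2) • (X - Xᴴ) := by
    rw [hMH, hM, Matrix.sqrtPencil]
    simp only [add_mul, mul_add, smul_mul_assoc, mul_smul_comm, one_mul, mul_one, smul_sub]
    abel
  have : X * N - (X * N)ᴴ = Nᴴ * (Mᴴ * X - Xᴴ * M) * N := by
    rw [mul_sub, sub_mul, ← mul_assoc, h2, one_mul, mul_assoc, mul_assoc, h1, mul_one,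
      conjTranspose_mul]
  rw [imP, this, key, imP]
  simp only [smul_mul_assoc, mul_smul_comm]
  rw [smul_comm]

/-- The `ℝ`-linear map `X ↦ c Im X`. -/
def Matrix.smulImPCLM (d : ℕ) (c : ℝ) :
    Matrix (Fin d) (Fin d) ℂ →L[ℝ] Matrix (Fin d) (Fin d) ℂ :=
  LinearMap.toContinuousLinearMap
    { toFun := fun X => (c : ℂ) • X.imP
      map_add' := fun X Y => by
        simp only [Matrix.imP, conjTranspose_add, ← smul_add]
        congr 2
        abel
      map_smul' := fun r X => by
        ext i j
        simp [Matrix.imP]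
        ring }

theorem Matrix.posSemidef_smul_imP_sqrtIntegral {d : ℕ} {X : Matrix (Fin d) (Fin d) ℂ}
    (hX : ∀ c ∈ spectrum ℂ X, c ∈ Complex.slitPlane) {c : ℝ}
    (h : ((c : ℂ) • X.imP).PosSemidef) : ((c : ℂ) • X.sqrtIntegral.imP).PosSemidef := by
  have hint : IntervalIntegrable (fun t : ℝ => X * Ring.inverse (X.sqrtPencil t)) volume 0
      (Real.pi / 2) :=
    (continuous_const.mul (continuous_inverse_sqrtPencil hX)).intervalIntegrable _ _
  change (smulImPCLM d c X.sqrtIntegral).PosSemidef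
  rw [sqrtIntegral, map_smul, ← ContinuousLinearMap.intervalIntegral_comp_comm _ hint,
    ← nonneg_iff_posSemidef, intervalIntegral.integral_of_le (by positivity)]
  refine smul_nonneg (by positivity) (integral_nonneg fun t => ?_)
  change 0 ≤ (c : ℂ) • (X * Ring.inverse (X.sqrtPencil t)).imP
  rw [imP_mul_inverse_sqrtPencil hX, nonneg_iff_posSemidef, smul_comm,
    ← smul_mul_assoc (c : ℂ), ← mul_smul_comm (c : ℂ)]
  have hs : (0 : ℂ) ≤ (Real.sin t : ℂ) ^ 2 := by
    rw [← Complex.ofReal_pow]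
    exact_mod_cast sq_nonneg (Real.sin t)
  exact (h.conjTranspose_mul_mul_same _).smul hs

theorem Matrix.isHermitian_of_smul_imP_posSemidef {d : ℕ} {F : ℂ → Matrix (Fin d) (Fin d) ℂ}
    {x : ℝ} (hF : ContinuousAt F x)
    (h : ∀ᶠ z in nhds (x : ℂ), (((z.im : ℂ)) • (F z).imP).PosSemidef) : (F x).IsHermitian := by
  have hcont : Continuous (Matrix.imP (d := d)) := by
    have := (smulImPCLM d 1).continuous
    exact this.congr fun X => by simp [smulImPCLM]
  have hlim : Tendsto (fun e : ℝ => (x + e * Complex.I : ℂ)) (nhds 0) (nhds x) := by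
    have : Continuous (fun e : ℝ => (x + e * Complex.I : ℂ)) := by fun_prop
    simpa using this.tendsto 0
  have hT : Tendsto (fun e : ℝ => (F (x + e * Complex.I)).imP) (nhds 0) (nhds (F x).imP) :=
    (hcont.tendsto _).comp (hF.tendsto.comp hlim)
  have hpos : ∀ᶠ e : ℝ in nhds 0, 0 ≤ e • (F (x + e * Complex.I)).imP := by
    filter_upwards [hlim.eventually h] with e he
    rw [nonneg_iff_posSemidef]
    simpa using he
  have h1 : 0 ≤ (F x).imP := by
    refine ge_of_tendsto (hT.mono_left (nhdsWithin_le_nhds (s := Set.Ioi 0))) ?_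
    filter_upwards [self_mem_nhdsWithin, nhdsWithin_le_nhds hpos] with e he h'
    have he : 0 < e := he
    simpa [smul_smul, he.ne'] using smul_nonneg (inv_nonneg.2 he.le) h'
  have h2 : (F x).imP ≤ 0 := by
    refine le_of_tendsto (hT.mono_left (nhdsWithin_le_nhds (s := Set.Iio 0))) ?_
    filter_upwards [self_mem_nhdsWithin, nhdsWithin_le_nhds hpos] with e he h'
    have he : e < 0 := he
    have := smul_nonneg (inv_nonneg.2 (neg_nonneg.2 he.le)) h'
    rw [smul_smul, inv_neg, neg_mul, inv_mul_cancel₀ he.ne, neg_smul, one_smul] at this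
    exact neg_nonneg.1 this
  have h3 := le_antisymm h2 h1
  rw [Matrix.imP, smul_eq_zero] at h3
  rcases h3 with h3 | h3
  · simp at h3
  · exact (sub_eq_zero.1 h3).symm

theorem sin_sq_add_cos_sq_mul_sq_ne_zero {e : ℝ} (he : 0 < e) (t : ℝ) :
    (Real.sin t : ℂ) ^ 2 + (Real.cos t : ℂ) ^ 2 * (e : ℂ) ^ 2 ≠ 0 := by
  have h : 0 < Real.sin t ^ 2 + Real.cos t ^ 2 * e ^ 2 := by
    rcases eq_or_ne (Real.sin t) 0 with h | h
    · have hc : Real.cos t ≠ 0 := fun hc => by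
        have := Real.sin_sq_add_cos_sq t
        simp [h, hc] at this
      positivity
    · positivity
  exact_mod_cast h.ne'

theorem continuous_sq_div_sin_sq_add_cos_sq_mul_sq {e : ℝ} (he : 0 < e) :
    Continuous fun t : ℝ =>
      (e : ℂ) ^ 2 / ((Real.sin t : ℂ) ^ 2 + (Real.cos t : ℂ) ^ 2 * (e : ℂ) ^ 2) :=
  continuous_const.div (by fun_prop) (sin_sq_add_cos_sq_mul_sq_ne_zero he)

theorem integral_sq_div_sin_sq_add_cos_sq_mul_sq {e : ℝ} (he : 0 < e) :
    ∫ t in (0 : ℝ)..(Real.pi / 2),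
      (e : ℂ) ^ 2 / ((Real.sin t : ℂ) ^ 2 + (Real.cos t : ℂ) ^ 2 * (e : ℂ) ^ 2) =
      (Real.pi / 2 : ℝ) * (e : ℂ) := by
  have hpi := Real.pi_pos
  have hslit : ∀ t ∈ Set.Icc (0 : ℝ) (Real.pi / 2), ∀ σ : ℝ, σ = 1 ∨ σ = -1 →
      ((e : ℂ) * (Real.cos t : ℂ) + σ * (Real.sin t : ℂ) * Complex.I) ∈ Complex.slitPlane := by
    intro t ht σ hσ
    rw [Complex.mem_slitPlane_iff]
    rcases eq_or_lt_of_le ht.2 with h | h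
    · right
      subst h
      rcases hσ with rfl | rfl <;> simp [-Complex.ofReal_cos, -Complex.ofReal_sin]
    · left
      have : 0 < Real.cos t := Real.cos_pos_of_mem_Ioo ⟨by linarith [ht.1], h⟩
      simpa [-Complex.ofReal_cos, -Complex.ofReal_sin] using mul_pos he this
  have hw : ∀ t : ℝ, ∀ σ : ℝ, HasDerivAt
      (fun t : ℝ => (e : ℂ) * (Real.cos t : ℂ) + σ * (Real.sin t : ℂ) * Complex.I)
      ((e : ℂ) * (-Real.sin t : ℝ) + σ * (Real.cos t : ℂ) * Complex.I) t := fun t σ =>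
    ((Real.hasDerivAt_cos t).ofReal_comp.const_mul _).add
      (((Real.hasDerivAt_sin t).ofReal_comp.const_mul _).mul_const _)
  have hderiv : ∀ t ∈ Set.uIcc (0 : ℝ) (Real.pi / 2), HasDerivAt
      (fun t : ℝ => (e : ℂ) / (2 * Complex.I) *
        (Complex.log ((e : ℂ) * (Real.cos t : ℂ) + (1 : ℝ) * (Real.sin t : ℂ) * Complex.I) -
         Complex.log ((e : ℂ) * (Real.cos t : ℂ) + (-1 : ℝ) * (Real.sin t : ℂ) * Complex.I)))
      ((e : ℂ) ^ 2 / ((Real.sin t : ℂ) ^ 2 + (Real.cos t : ℂ) ^ 2 * (e : ℂ) ^ 2)) t := by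
    intro t ht
    rw [Set.uIcc_of_le (by positivity)] at ht
    have h1 := hslit t ht 1 (Or.inl rfl)
    have h2 := hslit t ht (-1) (Or.inr rfl)
    refine ((((hw t 1).clog_real h1).sub ((hw t (-1)).clog_real h2)).const_mul _).congr_deriv ?_
    have n1 := Complex.slitPlane_ne_zero h1
    have n2 := Complex.slitPlane_ne_zero h2
    have n3 := sin_sq_add_cos_sq_mul_sq_ne_zero he t
    have hsc : (Real.sin t : ℂ) ^ 2 + (Real.cos t : ℂ) ^ 2 = 1 := by
      exact_mod_cast Real.sin_sq_add_cos_sq t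
    rw [Complex.ofReal_neg]
    generalize (Real.sin t : ℂ) = s at *
    generalize (Real.cos t : ℂ) = c at *
    rw [div_sub_div _ _ n1 n2, div_mul_div_comm, div_eq_div_iff
      (mul_ne_zero (by simp) (mul_ne_zero n1 n2)) n3]
    push_cast
    have hI := Complex.I_sq
    have hp : (e * c + 1 * s * I) * (e * c + -1 * s * I) = s ^ 2 + c ^ 2 * (e : ℂ) ^ 2 := by
      linear_combination -s ^ 2 * hI
    have hq : (e * -s + 1 * c * I) * (e * c + -1 * s * I) -
        (e * c + 1 * s * I) * (e * -s + -1 * c * I) = 2 * I * e := by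
      linear_combination 2 * I * e * hsc
    rw [hp, hq]
    ring
  rw [intervalIntegral.integral_eq_sub_of_hasDerivAt hderiv
    ((continuous_sq_div_sin_sq_add_cos_sq_mul_sq he).intervalIntegrable _ _)]
  simp [-Complex.ofReal_cos, -Complex.ofReal_sin, Complex.log_I, Complex.log_neg_I]
  field_simp
  ring

theorem Matrix.sqrtIntegral_mul_self {d : ℕ} {S : Matrix (Fin d) (Fin d) ℂ} (hS : S.PosDef) :
    (S * S).sqrtIntegral = S := by
  set U : Matrix (Fin d) (Fin d) ℂ := (hS.isHermitian.eigenvectorUnitary : Matrix (Fin d) (Fin d) ℂ) with hU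
  set e := hS.isHermitian.eigenvalues
  have he0 : ∀ k, 0 < e k := hS.eigenvalues_pos
  have hUU : Uᴴ * U = 1 := by
    simp [hU, ← star_eq_conjTranspose]
  have hUU' : U * Uᴴ = 1 := mul_eq_one_comm.1 hUU
  let Φ : (Fin d → ℂ) →L[ℂ] Matrix (Fin d) (Fin d) ℂ := LinearMap.toContinuousLinearMap
    { toFun := fun v => U * diagonal v * Uᴴ
      map_add' := fun v w => by
        rw [← add_mul, ← mul_add, diagonal_add]
        rfl
      map_smul' := fun c v => by simp [diagonal_smul] }
  have hΦ : ∀ v, Φ v = U * diagonal v * Uᴴ := fun v => rfl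
  have hmul : ∀ v w, Φ v * Φ w = Φ (v * w) := fun v w => by
    rw [hΦ, hΦ, hΦ]
    calc U * diagonal v * Uᴴ * (U * diagonal w * Uᴴ)
        = U * diagonal v * (Uᴴ * U) * diagonal w * Uᴴ := by simp only [mul_assoc]
      _ = U * diagonal (v * w) * Uᴴ := by
        rw [hUU, mul_one, mul_assoc U, diagonal_mul_diagonal]; rfl
  have hone : Φ 1 = 1 := by
    rw [hΦ, Pi.one_def, diagonal_one, mul_one, hUU']
  have hSΦ : S = Φ fun k => (e k : ℂ) := hS.isHermitian.spectral_theorem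
  have hinteg : ∀ t, S * S * Ring.inverse ((S * S).sqrtPencil t) = Φ fun k =>
      (e k : ℂ) ^ 2 / ((Real.sin t : ℂ) ^ 2 + (Real.cos t : ℂ) ^ 2 * (e k : ℂ) ^ 2) := by
    intro t
    have hp : (S * S).sqrtPencil t = Φ fun k =>
        (Real.sin t : ℂ) ^ 2 + (Real.cos t : ℂ) ^ 2 * (e k : ℂ) ^ 2 := by
      rw [sqrtPencil, ← hone, hSΦ, hmul, ← map_smul, ← map_smul, ← map_add]
      congr 1
      ext k
      simp [pow_two]
    have h1 : (S * S).sqrtPencil t * Φ (fun k =>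
        ((Real.sin t : ℂ) ^ 2 + (Real.cos t : ℂ) ^ 2 * (e k : ℂ) ^ 2)⁻¹) = 1 := by
      rw [hp, hmul, ← hone]
      congr 1
      ext k
      exact mul_inv_cancel₀ (sin_sq_add_cos_sq_mul_sq_ne_zero (he0 k) t)
    rw [← Matrix.nonsing_inv_eq_ringInverse, Matrix.inv_eq_right_inv h1, hSΦ, hmul, hmul]
    congr 1
    ext k
    simp [pow_two, div_eq_mul_inv]
  have hcont : Continuous fun (t : ℝ) (k : Fin d) =>
      (e k : ℂ) ^ 2 / ((Real.sin t : ℂ) ^ 2 + (Real.cos t : ℂ) ^ 2 * (e k : ℂ) ^ 2) :=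
    continuous_pi fun k => continuous_sq_div_sin_sq_add_cos_sq_mul_sq (he0 k)
  rw [sqrtIntegral, intervalIntegral.integral_congr fun t _ => hinteg t,
    Φ.intervalIntegral_comp_comm (hcont.intervalIntegrable _ _)]
  have hval : (∫ t in (0 : ℝ)..(Real.pi / 2), fun k : Fin d =>
      (e k : ℂ) ^ 2 / ((Real.sin t : ℂ) ^ 2 + (Real.cos t : ℂ) ^ 2 * (e k : ℂ) ^ 2)) =
      (Real.pi / 2 : ℝ) • fun k => (e k : ℂ) := by
    ext k
    have := (ContinuousLinearMap.proj (R := ℂ) (φ := fun _ : Fin d => ℂ)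
      k).intervalIntegral_comp_comm (hcont.intervalIntegrable (μ := volume) 0 (Real.pi / 2))
    refine this.symm.trans ((integral_sq_div_sin_sq_add_cos_sq_mul_sq (he0 k)).trans ?_)
    simp
  rw [hval, ← Complex.coe_smul, ← Complex.coe_smul, map_smul, smul_smul, ← hSΦ]
  have : ((2 / Real.pi : ℝ) : ℂ) * ((Real.pi / 2 : ℝ) : ℂ) = 1 := by
    rw [← Complex.ofReal_mul]
    have := Real.pi_ne_zero
    norm_cast
    field_simp
  rw [this, one_smul]

theorem Matrix.eq_of_mul_self_eq_of_posDef {d : ℕ} {R S : Matrix (Fin d) (Fin d) ℂ}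
    (hS : S.PosDef) (hRS : R * R = S * S) (hR : ∀ c ∈ spectrum ℂ R, 0 < c.re) : R = S := by
  rw [← sub_eq_zero]
  have hX : R * (R - S) = -((R - S) * S) := by
    rw [mul_sub, sub_mul, hRS]
    abel
  set e := hS.isHermitian.eigenvalues
  set b := hS.isHermitian.eigenvectorBasis
  have hzero : ∀ k, (R - S) *ᵥ (b k).ofLp = 0 := by
    intro k
    by_contra hne
    have hRw : R *ᵥ ((R - S) *ᵥ (b k).ofLp) = (-(e k : ℂ)) • ((R - S) *ᵥ (b k).ofLp) := by
      have hb : S *ᵥ (b k).ofLp = (e k : ℂ) • (b k).ofLp := by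
        rw [Complex.coe_smul]
        exact hS.isHermitian.mulVec_eigenvectorBasis k
      rw [mulVec_mulVec, hX, neg_mulVec, ← mulVec_mulVec, hb, mulVec_smul, neg_smul]
    have hmem : (-(e k : ℂ)) ∈ spectrum ℂ R := by
      rw [← Matrix.spectrum_toLin']
      refine Module.End.HasEigenvalue.mem_spectrum
        (Module.End.hasEigenvalue_of_hasEigenvector (x := (R - S) *ᵥ (b k).ofLp) ?_)
      exact ⟨Module.End.mem_eigenspace_iff.2 (by simpa using hRw), hne⟩
    have := hR _ hmem
    have he : 0 < e k := hS.eigenvalues_pos k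
    simp at this
    linarith
  have hU : (R - S) * (hS.isHermitian.eigenvectorUnitary : Matrix (Fin d) (Fin d) ℂ) = 0 := by
    ext i k
    exact congrFun (hzero k) i
  have hUU : (hS.isHermitian.eigenvectorUnitary : Matrix (Fin d) (Fin d) ℂ) *
      star (hS.isHermitian.eigenvectorUnitary : Matrix (Fin d) (Fin d) ℂ) = 1 := by simp
  rw [← mul_one (R - S), ← hUU, ← mul_assoc, hU, zero_mul]

theorem Matrix.IsHermitian.posDef_of_spectrum_subset_slitPlane {d : ℕ}
    {X : Matrix (Fin d) (Fin d) ℂ} (hX : X.IsHermitian)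
    (h : ∀ c ∈ spectrum ℂ X, c ∈ Complex.slitPlane) : X.PosDef := by
  refine hX.posDef_iff_eigenvalues_pos.2 fun i => ?_
  exact Complex.ofReal_mem_slitPlane.1 (h _ ((spectrum.algebraMap_mem_iff ℂ).2
    (hX.eigenvalues_mem_spectrum_real i)))

theorem Matrix.PosDef.posDef_sqrt {d : ℕ} {X : Matrix (Fin d) (Fin d) ℂ} (hX : X.PosDef) :
    (CFC.sqrt X).PosDef := by
  have h0 : (CFC.sqrt X).PosSemidef := nonneg_iff_posSemidef.1 (CFC.sqrt_nonneg X)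
  have hu : IsUnit (CFC.sqrt X * CFC.sqrt X) := by
    rw [CFC.sqrt_mul_sqrt_self X (nonneg_iff_posSemidef.2 hX.posSemidef)]
    exact hX.isUnit
  exact h0.posDef_iff_isUnit.2 ((Commute.refl _).isUnit_mul_iff.1 hu).1

/-- if `A` is a matrix-valued complete Bernstein function whose analytic
continuation `F` has no eigenvalue in `(−∞,0]` anywhere on the cut plane, then the
principal square root `x ↦ A(x)^{1/2}` is again a matrix-valued complete Bernstein
function.  The principal square root is formalized as any function `R` with
`R(x)² = A(x)` whose (complexified) spectrum lies in the open right half-plane. -/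
theorem mvCBF_principal_sqrt {d : ℕ}
    (A : ℝ → Matrix (Fin d) (Fin d) ℝ) (F : ℂ → Matrix (Fin d) (Fin d) ℂ)
    (hAF : IsMvCBFWith A F)
    (hspec : ∀ z ∈ Complex.slitPlane, ∀ c ∈ spectrum ℂ (F z), c ∈ Complex.slitPlane)
    (R : ℝ → Matrix (Fin d) (Fin d) ℝ)
    (hsq : ∀ x : ℝ, 0 < x → R x * R x = A x)
    (hhalf : ∀ x : ℝ, 0 < x →
      ∀ c ∈ spectrum ℂ ((R x).map (fun t => (t : ℂ))), 0 < c.re) :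
    IsMvCBF R := by
  obtain ⟨hdiff, hreal, hpos, L, hL⟩ := hAF
  have hF : DifferentiableOn ℂ F Complex.slitPlane :=
    differentiableOn_pi.2 fun i => differentiableOn_pi.2 fun j => hdiff i j
  have hmem : ∀ x : ℝ, 0 < x → (x : ℂ) ∈ Complex.slitPlane := fun x hx =>
    Complex.ofReal_mem_slitPlane.2 hx
  have hPD : ∀ x : ℝ, 0 < x → (F x).PosDef := fun x hx => by
    have hn := Complex.isOpen_slitPlane.mem_nhds (hmem x hx)
    refine Matrix.IsHermitian.posDef_of_spectrum_subset_slitPlane ?_ (hspec x (hmem x hx))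
    refine Matrix.isHermitian_of_smul_imP_posSemidef (hF.differentiableAt hn).continuousAt ?_
    filter_upwards [hn] with z hz using hpos z hz
  have hsqrt : ∀ x : ℝ, 0 < x → CFC.sqrt (F x) * CFC.sqrt (F x) = F x := fun x hx =>
    CFC.sqrt_mul_sqrt_self _ (Matrix.nonneg_iff_posSemidef.2 (hPD x hx).posSemidef)
  have hR : ∀ x : ℝ, 0 < x → (R x).map (fun t => (t : ℂ)) = CFC.sqrt (F x) := fun x hx => by
    refine Matrix.eq_of_mul_self_eq_of_posDef (hPD x hx).posDef_sqrt ?_ (hhalf x hx)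
    rw [hsqrt x hx, hreal x hx, ← hsq x hx]
    exact (Matrix.map_mul (f := Complex.ofRealHom)).symm
  refine ⟨fun z => (F z).sqrtIntegral, fun i j => ?_, fun x hx => ?_, fun z hz => ?_, ?_⟩
  · exact differentiableOn_pi.1 (differentiableOn_pi.1
      (differentiableOn_sqrtIntegral Complex.isOpen_slitPlane hF hspec) i) j
  · rw [hR x hx]
    have := Matrix.sqrtIntegral_mul_self (hPD x hx).posDef_sqrt
    rwa [hsqrt x hx] at this
  · exact Matrix.posSemidef_smul_imP_sqrtIntegral (hspec z hz) (hpos z hz)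
  · have hcoe : Continuous fun X : Matrix (Fin d) (Fin d) ℝ => X.map (fun t => (t : ℂ)) :=
      continuous_id.matrix_map Complex.continuous_ofReal
    have hlim : Tendsto (fun x : ℝ => F x) (nhdsWithin 0 (Set.Ioi 0))
        (nhds (L.map (fun t => (t : ℂ)))) := by
      refine ((hcoe.tendsto L).comp hL).congr' ?_
      filter_upwards [self_mem_nhdsWithin] with x hx using (hreal x hx).symm
    have hF0 : ∀ᶠ x : ℝ in nhdsWithin 0 (Set.Ioi 0), 0 ≤ F x := by
      filter_upwards [self_mem_nhdsWithin] with x hx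
        using Matrix.nonneg_iff_posSemidef.2 (hPD x hx).posSemidef
    have hL0 := ge_of_tendsto hlim hF0
    have hs := (CFC.continuousOn_sqrt _ hL0).tendsto.comp
      (tendsto_nhdsWithin_iff.2 ⟨hlim, hF0⟩)
    have hre : Continuous fun X : Matrix (Fin d) (Fin d) ℂ => X.map Complex.re :=
      continuous_id.matrix_map Complex.continuous_re
    refine ⟨_, ((hre.tendsto _).comp hs).congr' ?_⟩
    filter_upwards [self_mem_nhdsWithin] with x hx
    simp only [Function.comp_apply, ← hR x hx]
    ext i j
    simp
end
end

section
/- Let A : (0,∞) → M_d(ℝ) be a matrix-valued complete Bernstein function such that its analytic continuation A(z) is invertible for every z ∈ ℂ ∖ (−∞,0], and such that lim_{x→0+} A(x)^{-1} exists and is real positive semidefinite. Then the function x ↦ A(x)^{-1} is a matrix-valued Stieltjes function. -/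
open MeasureTheory Complex Filter
open scoped ComplexOrder Matrix

noncomputable section

/-- `G` witnesses that `A : (0,∞) → M_d(ℝ)` is a matrix-valued Stieltjes function:
`G` is an analytic continuation of `A` to `ℂ ∖ (−∞,0]` with `(Im z)·Im G(z) ≤ 0`
there, and `A` has a real positive semidefinite limit at `0+`. -/
def IsMvStieltjesWith {d : ℕ} (A : ℝ → Matrix (Fin d) (Fin d) ℝ)
    (G : ℂ → Matrix (Fin d) (Fin d) ℂ) : Prop :=
  (∀ i j, DifferentiableOn ℂ (fun z => G z i j) Complex.slitPlane) ∧
  (∀ x : ℝ, 0 < x → G (x : ℂ) = (A x).map (fun t => (t : ℂ))) ∧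
  (∀ z ∈ Complex.slitPlane, (-(((z.im : ℂ)) • (G z).imP)).PosSemidef) ∧
  (∃ L : Matrix (Fin d) (Fin d) ℝ,
    Tendsto A (nhdsWithin 0 (Set.Ioi 0)) (nhds L) ∧ L.PosSemidef)

/-- `A : (0,∞) → M_d(ℝ)` is a matrix-valued Stieltjes function. -/
def IsMvStieltjes {d : ℕ} (A : ℝ → Matrix (Fin d) (Fin d) ℝ) : Prop :=
  ∃ G : ℂ → Matrix (Fin d) (Fin d) ℂ, IsMvStieltjesWith A G

theorem Matrix.imP_inv {d : ℕ} {X : Matrix (Fin d) (Fin d) ℂ} (hX : IsUnit X) :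
    (X⁻¹).imP = -(X⁻¹ * X.imP * (X⁻¹)ᴴ) := by
  have hdet := (Matrix.isUnit_iff_isUnit_det X).mp hX
  have h₁ : X⁻¹ * X = 1 := Matrix.nonsing_inv_mul X hdet
  have h₂ : Xᴴ * (X⁻¹)ᴴ = 1 := by
    rw [← Matrix.conjTranspose_mul, h₁, Matrix.conjTranspose_one]
  have h : X⁻¹ * (X - Xᴴ) * (X⁻¹)ᴴ = (X⁻¹)ᴴ - X⁻¹ := by
    rw [mul_sub, sub_mul, h₁, one_mul, mul_assoc, h₂, mul_one]
  rw [Matrix.imP, Matrix.imP, Matrix.mul_smul, Matrix.smul_mul, h, ← smul_neg, neg_sub]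

theorem DifferentiableOn.matrix_det_apply {n : ℕ} {s : Set ℂ}
    {F : ℂ → Matrix (Fin n) (Fin n) ℂ}
    (hF : ∀ i j, DifferentiableOn ℂ (fun z => F z i j) s) :
    DifferentiableOn ℂ (fun z => (F z).det) s := by
  simp only [Matrix.det_apply']
  exact DifferentiableOn.fun_sum fun σ _ =>
    (DifferentiableOn.fun_finsetProd fun i _ => hF (σ i) i).const_mul _

theorem DifferentiableOn.matrix_inv_apply {n : ℕ} {s : Set ℂ}
    {F : ℂ → Matrix (Fin n) (Fin n) ℂ}
    (hF : ∀ i j, DifferentiableOn ℂ (fun z => F z i j) s)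
    (hinv : ∀ z ∈ s, IsUnit (F z)) (i j : Fin n) :
    DifferentiableOn ℂ (fun z => (F z)⁻¹ i j) s := by
  simp only [Matrix.inv_def, Matrix.smul_apply, Ring.inverse_eq_inv', smul_eq_mul,
    Matrix.adjugate_apply]
  refine (DifferentiableOn.fun_inv (DifferentiableOn.matrix_det_apply hF) fun z hz =>
    ((Matrix.isUnit_iff_isUnit_det _).mp (hinv z hz)).ne_zero).mul
      (DifferentiableOn.matrix_det_apply fun k l => ?_)
  by_cases hk : k = j
  · subst hk
    simp only [Matrix.updateRow_self]
    exact differentiableOn_const _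
  · simpa only [Matrix.updateRow_ne hk] using hF k l

theorem Matrix.inv_map_ofReal {n : ℕ} (M : Matrix (Fin n) (Fin n) ℝ) :
    (M.map (fun t => (t : ℂ)))⁻¹ = M⁻¹.map (fun t => (t : ℂ)) := by
  have hdet : (M.map (fun t => (t : ℂ))).det = (M.det : ℂ) :=
    (RingHom.map_det Complex.ofRealHom M).symm
  have hadj : (M.map (fun t => (t : ℂ))).adjugate = M.adjugate.map (fun t => (t : ℂ)) :=
    (RingHom.map_adjugate Complex.ofRealHom M).symm
  ext i j
  simp [Matrix.inv_def, hdet, hadj]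

/-- if `A` is a matrix-valued complete Bernstein function whose analytic
continuation is invertible everywhere on the cut plane, and `lim_{x→0+} A(x)⁻¹` exists
and is (real) positive semidefinite, then `x ↦ A(x)⁻¹` is a matrix-valued Stieltjes
function. -/
theorem mvCBF_inv_isStieltjes {d : ℕ}
    (A : ℝ → Matrix (Fin d) (Fin d) ℝ) (F : ℂ → Matrix (Fin d) (Fin d) ℂ)
    (hAF : IsMvCBFWith A F)
    (hinv : ∀ z ∈ Complex.slitPlane, IsUnit (F z))
    (hlim : ∃ L : Matrix (Fin d) (Fin d) ℝ,
      Tendsto (fun x : ℝ => (A x)⁻¹) (nhdsWithin 0 (Set.Ioi 0)) (nhds L) ∧ L.PosSemidef) :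
    IsMvStieltjes (fun x : ℝ => (A x)⁻¹) := by
  obtain ⟨hdiff, hreal, hpos, -⟩ := hAF
  refine ⟨fun z => (F z)⁻¹, DifferentiableOn.matrix_inv_apply hdiff hinv,
    fun x hx => ?_, fun z hz => ?_, hlim⟩
  · beta_reduce
    rw [hreal x hx, Matrix.inv_map_ofReal]
  · beta_reduce
    rw [Matrix.imP_inv (hinv z hz), smul_neg, neg_neg, ← Matrix.smul_mul, ← Matrix.mul_smul]
    exact (hpos z hz).mul_mul_conjTranspose_same _
end
end

section
/- Let G = (G_{klmn}), k,l,m,n ∈ {1,2,3}, be a complex 4-index array such that Re Σ_{k,l,m,n} conj(e_{kl})·G_{klmn}·e_{mn} ≥ 0 for every complex 3×3 matrix e. Let a, k ∈ ℂ³, ω ∈ ℝ, ρ ∈ ℝ satisfy the eigenvalue relation Σ_{l,m,n} G_{klmn}·k_l·k_n·a_m = −i·ω·ρ·a_k for each index k ∈ {1,2,3}. Then Σ_{l} Im[ Σ_{k,m,n} conj(a_k)·G_{klmn}·a_m·k_n ]·Im(k_l) ≥ 0. (In viscoelastic terms: with G̃(−iω) the Fourier-transformed relaxation modulus of a medium with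 causal positive definite relaxation, the time-averaged energy flux density of an inhomogeneous plane wave makes an acute angle with the attenuation vector Im k.) -/
open Complex

/-- Contracting the complex energy flux with a vector `w`. -/
lemma sum_flux_mul (G : Fin 3 → Fin 3 → Fin 3 → Fin 3 → ℂ) (a kv w : Fin 3 → ℂ) :
    ∑ l, (∑ k, ∑ m, ∑ n, (starRingEnd ℂ) (a k) * G k l m n * a m * kv n) * w l
      = ∑ k, (starRingEnd ℂ) (a k) * ∑ l, ∑ m, ∑ n, G k l m n * w l * kv n * a m := by
  simp only [Finset.sum_mul, Finset.mul_sum]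
  rw [Finset.sum_comm]
  refine Finset.sum_congr rfl fun k _ => Finset.sum_congr rfl fun l _ =>
    Finset.sum_congr rfl fun m _ => Finset.sum_congr rfl fun n _ => ?_
  ring

lemma two_mul_im_mul_im (z w : ℂ) :
    2 * (z.im * w.im) = (z * (starRingEnd ℂ) w).re - (z * w).re := by
  simp only [mul_re, conj_re, conj_im]
  ring

/-- let `G = (G_{klmn})` be a complex 4-index array on `{1,2,3}` with
`Re Σ conj(e_{kl})·G_{klmn}·e_{mn} ≥ 0` for every complex 3×3 array `e` (the real part
of the Fourier-transformed relaxation modulus is positive semidefinite), and suppose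
`a, k ∈ ℂ³`, `ω, ρ ∈ ℝ` satisfy `Σ G_{klmn}·k_l·k_n·a_m = −i·ω·ρ·a_k` (the plane-wave
equation of motion).  Then `Σ_l Im[Σ conj(a_k)·G_{klmn}·a_m·k_n]·Im(k_l) ≥ 0`:
the time-averaged energy flux density makes an acute angle with the attenuation
vector `Im k`. -/
theorem energy_flux_attenuation_acute
    (G : Fin 3 → Fin 3 → Fin 3 → Fin 3 → ℂ)
    (hG : ∀ e : Fin 3 → Fin 3 → ℂ,
      0 ≤ (∑ k, ∑ l, ∑ m, ∑ n, (starRingEnd ℂ) (e k l) * G k l m n * e m n).re)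
    (a kv : Fin 3 → ℂ) (ω ρ : ℝ)
    (heq : ∀ k, ∑ l, ∑ m, ∑ n, G k l m n * kv l * kv n * a m
      = -Complex.I * (ω : ℂ) * (ρ : ℂ) * a k) :
    0 ≤ ∑ l, (∑ k, ∑ m, ∑ n, (starRingEnd ℂ) (a k) * G k l m n * a m * kv n).im
        * (kv l).im := by
  have hpos : 0 ≤ (∑ l, (∑ k, ∑ m, ∑ n, (starRingEnd ℂ) (a k) * G k l m n * a m * kv n)
      * (starRingEnd ℂ) (kv l)).re := by
    rw [sum_flux_mul G a kv fun l => (starRingEnd ℂ) (kv l)]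
    convert hG fun k l => a k * kv l using 2
    simp only [Finset.mul_sum, map_mul]
    refine Finset.sum_congr rfl fun k _ => Finset.sum_congr rfl fun l _ =>
      Finset.sum_congr rfl fun m _ => Finset.sum_congr rfl fun n _ => ?_
    ring
  have hzero : (∑ l, (∑ k, ∑ m, ∑ n, (starRingEnd ℂ) (a k) * G k l m n * a m * kv n)
      * kv l).re = 0 := by
    rw [sum_flux_mul, re_sum]
    refine Finset.sum_eq_zero fun k _ => ?_
    rw [heq]
    simp
    ring
  rw [re_sum] at hpos hzero
  refine nonneg_of_mul_nonneg_right (a := (2 : ℝ)) ?_ two_pos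
  rw [Finset.mul_sum]
  simp only [two_mul_im_mul_im, Finset.sum_sub_distrib]
  rw [hzero, sub_zero]
  exact hpos
end
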